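/- arXiv:2408.13837 — 3 statements merged into one kernel-verified Lean document; each statement's English description precedes it below -/
import Mathlib

section
/- Let X be a Banach space and let Y₁, M, N, Y₂ be closed linear subspaces of X such that M+N is closed and Y₁ ⊆ M∩N ⊆ M+N ⊆ Y₂. Assume dim(Y₂/(M+N)) is finite. Then there exists ε > 0 such that for every triple (M′, N′, Y₂′) of closed linear subspaces of X with M′+N′ ⊆ Y₂′ and δ(M,M′) < ε, δ(N,N′) < ε, δ(Y₂′,Y₂) < ε, the subspace M′+N′ is closed and dim(Y₂′/(M′+N′)) ≤ dim(Y₂/(M+N)). -/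
open scoped Classical

/-- The gap `δ(M,N)` between two linear subspaces of a normed space:
`δ(M,N) = sup_{u ∈ M, ‖u‖ = 1} dist(u, N)` (and `0` if `M = {0}`,
since the supremum of the empty set of reals is `0`). -/
noncomputable def gapSub {X : Type*} [NormedAddCommGroup X] [NormedSpace ℂ X]
    (M N : Submodule ℂ X) : ℝ :=
  sSup ((fun u => Metric.infDist u (N : Set X)) '' {u : X | u ∈ M ∧ ‖u‖ = 1})

/-- The symmetric gap `δ̂(M,N) = max (δ(M,N), δ(N,M))`. -/
noncomputable def hatGap {X : Type*} [NormedAddCommGroup X] [NormedSpace ℂ X]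
    (M N : Submodule ℂ X) : ℝ :=
  max (gapSub M N) (gapSub N M)

/-- The minimum gap `γ(M,N)`: the infimum of `dist(u,N)/dist(u, M ⊓ N)` over
`u ∈ M \ N`, and `1` if `M ⊆ N`. -/
noncomputable def minGap {X : Type*} [NormedAddCommGroup X] [NormedSpace ℂ X]
    (M N : Submodule ℂ X) : ℝ :=
  if M ≤ N then 1
  else sInf ((fun u => Metric.infDist u (N : Set X) /
      Metric.infDist u ((M ⊓ N : Submodule ℂ X) : Set X)) '' {u : X | u ∈ M ∧ u ∉ N})

/-- The rank (dimension, as a cardinal) of the quotient `B / A` for submodules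
`A ≤ B` of `X`. -/
noncomputable def quotRank {X : Type*} [NormedAddCommGroup X] [NormedSpace ℂ X]
    (A B : Submodule ℂ X) : Cardinal :=
  Module.rank ℂ (↥B ⧸ A.comap B.subtype)

/-- The quotient `B / A` is finite dimensional. -/
def QuotFin {X : Type*} [NormedAddCommGroup X] [NormedSpace ℂ X]
    (A B : Submodule ℂ X) : Prop :=
  FiniteDimensional ℂ (↥B ⧸ A.comap B.subtype)

/-- The finite dimension of the quotient `B / A`. -/
noncomputable def quotFinrank {X : Type*} [NormedAddCommGroup X] [NormedSpace ℂ X]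
    (A B : Submodule ℂ X) : ℕ :=
  Module.finrank ℂ (↥B ⧸ A.comap B.subtype)


lemma gap_approx {X : Type*} [NormedAddCommGroup X] [NormedSpace ℂ X]
    (M M' : Submodule ℂ X) {ε : ℝ} (h : gapSub M M' < ε) (u : X) (hu : u ∈ M) :
    ∃ m ∈ M', ‖u - m‖ ≤ ε * ‖u‖ := by
  by_cases h0 : u = 0
  · exact ⟨0, M'.zero_mem, by simp [h0]⟩
  have hn : 0 < ‖u‖ := norm_pos_iff.mpr h0
  set v : X := ((‖u‖⁻¹ : ℝ) : ℂ) • u with hv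
  have hvn : ‖v‖ = 1 := by
    rw [hv, norm_smul, Complex.norm_real, norm_inv, norm_norm]
    exact inv_mul_cancel₀ hn.ne'
  have hvM : v ∈ M := M.smul_mem _ hu
  have hle : Metric.infDist v (M' : Set X) ≤ gapSub M M' := by
    apply le_csSup
    · refine ⟨1, ?_⟩
      rintro _ ⟨w, ⟨_, hw⟩, rfl⟩
      have := Metric.infDist_le_dist_of_mem (x := w) (M'.zero_mem : (0:X) ∈ (M' : Set X))
      simpa [hw] using this
    · exact ⟨v, ⟨hvM, hvn⟩, rfl⟩
  obtain ⟨m, hm, hd⟩ := (Metric.infDist_lt_iff ⟨0, M'.zero_mem⟩).1 (lt_of_le_of_lt hle h)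
  refine ⟨((‖u‖ : ℝ) : ℂ) • m, M'.smul_mem _ hm, ?_⟩
  have hu' : u = ((‖u‖ : ℝ) : ℂ) • v := by
    rw [hv, smul_smul, ← Complex.ofReal_mul, mul_inv_cancel₀ hn.ne']; simp
  have : u - ((‖u‖ : ℝ) : ℂ) • m = ((‖u‖ : ℝ) : ℂ) • (v - m) := by
    rw [smul_sub, ← hu']
  rw [this, norm_smul, Complex.norm_real, norm_norm, mul_comm]
  rw [dist_eq_norm] at hd
  gcongr

lemma le_sup_of_approx {X : Type*} [NormedAddCommGroup X] [NormedSpace ℂ X]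
    [CompleteSpace X] (M N W : Submodule ℂ X)
    (hM : IsClosed (M : Set X)) (hN : IsClosed (N : Set X)) (hW : M ⊔ N ≤ W) (K : ℝ)
    (h : ∀ y ∈ W, ∃ m ∈ M, ∃ n ∈ N, ‖m‖ ≤ K * ‖y‖ ∧ ‖n‖ ≤ K * ‖y‖ ∧
      ‖y - (m + n)‖ ≤ (1/2) * ‖y‖) : W ≤ M ⊔ N := by
  intro y hy
  have h' : ∀ y : W, ∃ m : M, ∃ n : N, ‖m‖ ≤ K * ‖y‖ ∧ ‖n‖ ≤ K * ‖y‖ ∧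
      ‖(y : X) - (m + n)‖ ≤ (1/2) * ‖y‖ := by
    rintro ⟨y, hy⟩
    obtain ⟨m, hm, n, hn, h⟩ := h y hy
    exact ⟨⟨m, hm⟩, ⟨n, hn⟩, h⟩
  choose f g hf hg hfg using h'
  let step : W → W := fun w => ⟨(w : X) - (f w + g w), W.sub_mem w.2
    (hW (Submodule.add_mem_sup (f w).2 (g w).2))⟩
  let r : ℕ → W := fun k => step^[k] ⟨y, hy⟩
  have hr0 : (r 0 : X) = y := rfl
  have hrs : ∀ k, (r (k+1) : X) = r k - (f (r k) + g (r k)) := by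
    intro k
    simp only [r, Function.iterate_succ_apply']
    rfl
  have hrn : ∀ k, ‖r k‖ ≤ (1/2)^k * ‖y‖ := by
    intro k
    induction k with
    | zero => simp [r]
    | succ k ih =>
      have := hfg (r k)
      rw [← hrs] at this
      calc ‖r (k+1)‖ ≤ 1/2 * ‖r k‖ := this
        _ ≤ 1/2 * ((1/2)^k * ‖y‖) := by gcongr
        _ = _ := by ring
  have hgeo : Summable (fun k : ℕ => |K| * ((1/2:ℝ)^k * ‖y‖)) :=
    (summable_geometric_two.mul_right _).mul_left _
  have hb : ∀ k, K * ‖r k‖ ≤ |K| * ((1/2:ℝ)^k * ‖y‖) := fun k =>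
    mul_le_mul (le_abs_self K) (hrn k) (norm_nonneg _) (abs_nonneg _)
  have hsf : Summable (fun k => (f (r k) : X)) :=
    Summable.of_norm_bounded hgeo (fun k => (hf (r k)).trans (hb k))
  have hsg : Summable (fun k => (g (r k) : X)) :=
    Summable.of_norm_bounded hgeo (fun k => (hg (r k)).trans (hb k))
  have hmM : ∑' k, (f (r k) : X) ∈ M :=
    hM.mem_of_tendsto hsf.hasSum.tendsto_sum_nat
      (Filter.Eventually.of_forall fun n => M.sum_mem fun i _ => (f (r i)).2)
  have hnN : ∑' k, (g (r k) : X) ∈ N :=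
    hN.mem_of_tendsto hsg.hasSum.tendsto_sum_nat
      (Filter.Eventually.of_forall fun n => N.sum_mem fun i _ => (g (r i)).2)
  have hpart : ∀ n, ∑ k ∈ Finset.range n, ((f (r k) : X) + g (r k)) = y - r n := by
    intro n
    induction n with
    | zero => simp [hr0]
    | succ n ih => rw [Finset.sum_range_succ, ih, hrs]; abel
  have hr : Filter.Tendsto (fun n => (r n : X)) Filter.atTop (nhds 0) := by
    apply squeeze_zero_norm (a := fun n : ℕ => (1/2:ℝ)^n * ‖y‖) (f := fun n => (r n : X)) (fun n => hrn n)
    have := (tendsto_pow_atTop_nhds_zero_of_lt_one (r := (1/2:ℝ)) (by norm_num)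
      (by norm_num)).mul_const ‖y‖
    simpa using this
  have h1 := (hsf.add hsg).hasSum.tendsto_sum_nat
  simp only [hpart] at h1
  have h2 : Filter.Tendsto (fun n => y - (r n : X)) Filter.atTop (nhds (y - 0)) :=
    hr.const_sub y
  have h3 := tendsto_nhds_unique h2 h1
  rw [sub_zero, hsf.tsum_add hsg] at h3
  rw [h3]
  exact Submodule.add_mem_sup hmM hnN

lemma rank_le_of_le_sup {X : Type*} [NormedAddCommGroup X] [NormedSpace ℂ X]
    (Z Y : Submodule ℂ X) (k : ℕ) (u : Fin k → X) (hu : ∀ i, u i ∈ Y)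
    (h : Y ≤ Z ⊔ Submodule.span ℂ (Set.range u)) : quotRank Z Y ≤ k := by
  let φ : (Fin k → ℂ) →ₗ[ℂ] (↥Y ⧸ Z.comap Y.subtype) :=
    (Z.comap Y.subtype).mkQ ∘ₗ Fintype.linearCombination ℂ (fun i => (⟨u i, hu i⟩ : Y))
  have hs : Function.Surjective φ := by
    intro q
    obtain ⟨y, rfl⟩ := Submodule.mkQ_surjective _ q
    obtain ⟨z, hz, s, hs, hzs⟩ := Submodule.mem_sup.1 (h y.2)
    obtain ⟨c, rfl⟩ := (Submodule.mem_span_range_iff_exists_fun ℂ).1 hs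
    refine ⟨c, ?_⟩
    simp only [φ, LinearMap.comp_apply]
    rw [← sub_eq_zero, ← map_sub, Submodule.mkQ_apply, Submodule.Quotient.mk_eq_zero,
      Submodule.mem_comap]
    simp only [Fintype.linearCombination_apply, Submodule.subtype_apply, Submodule.coe_sub,
      Submodule.coe_sum, Submodule.coe_smul]
    rw [← hzs]
    simpa using hz
  have hf : Module.Finite ℂ (↥Y ⧸ Z.comap Y.subtype) := Module.Finite.of_surjective φ hs
  have := LinearMap.finrank_le_finrank_of_surjective (f := φ) hs
  unfold quotRank
  rw [← Module.finrank_eq_rank]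
  simp only [Module.finrank_fin_fun] at this
  exact_mod_cast this

lemma riesz_family {X : Type*} [NormedAddCommGroup X] [NormedSpace ℂ X]
    (Z Y : Submodule ℂ X) (hZ : IsClosed (Z : Set X)) (hZY : Z ≤ Y)
    (k : ℕ) (hk : (k : Cardinal) ≤ quotRank Z Y) :
    ∃ u : Fin k → X, (∀ i, u i ∈ Y) ∧ (∀ i, ‖u i‖ ≤ 1) ∧
      ∀ (c : Fin k → ℂ), ∀ z ∈ Z, ∀ i, ‖c i‖ ≤ 3 ^ k * ‖∑ i, c i • u i - z‖ := by
  induction k with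
  | zero => exact ⟨fun i => i.elim0, fun i => i.elim0, fun i => i.elim0, fun _ _ _ i => i.elim0⟩
  | succ k ih =>
    obtain ⟨u, huY, hu1, huc⟩ := ih (le_trans (by exact_mod_cast Nat.le_succ k) hk)
    have hnot : ¬ Y ≤ Z ⊔ Submodule.span ℂ (Set.range u) := by
      intro h
      have := hk.trans (rank_le_of_le_sup Z Y k u huY h)
      have : k + 1 ≤ k := by exact_mod_cast this
      omega
    set W := Z ⊔ Submodule.span ℂ (Set.range u) with hWdef
    have hfd : FiniteDimensional ℂ (Submodule.span ℂ (Set.range u)) :=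
      FiniteDimensional.span_of_finite ℂ (Set.finite_range u)
    have hWc : IsClosed (W : Set X) := Submodule.isClosed_sup_finiteDimensional _ _ hZ
    have hWc' : IsClosed ((W.comap Y.subtype : Submodule ℂ Y) : Set Y) :=
      hWc.preimage continuous_subtype_val
    have hex : ∃ x : Y, x ∉ W.comap Y.subtype := by
      obtain ⟨y, hy, hyW⟩ := Set.not_subset.1 hnot
      exact ⟨⟨y, hy⟩, hyW⟩
    obtain ⟨x, hxW, hx⟩ := riesz_lemma hWc' hex (r := 1/2) (by norm_num)
    have hWY : W ≤ Y := sup_le hZY (Submodule.span_le.2 (by rintro _ ⟨i, rfl⟩; exact huY i))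
    have hx' : ∀ w ∈ W, 1/2 * ‖(x : X)‖ ≤ ‖(x : X) - w‖ := by
      intro w hw
      exact hx ⟨w, hWY hw⟩ hw
    have hx0 : (x : X) ≠ 0 := by
      intro h
      apply hxW
      rw [Submodule.mem_comap, Submodule.subtype_apply, h]
      exact W.zero_mem
    have hn : 0 < ‖(x : X)‖ := norm_pos_iff.mpr hx0
    set v : X := ((‖(x : X)‖⁻¹ : ℝ) : ℂ) • (x : X) with hv
    have hvn : ‖v‖ = 1 := by
      rw [hv, norm_smul, Complex.norm_real, norm_inv, norm_norm]
      exact inv_mul_cancel₀ hn.ne'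
    have hvY : v ∈ Y := Y.smul_mem _ x.2
    have hvc : ∀ (c : ℂ), ∀ w ∈ W, ‖c‖ ≤ 2 * ‖c • v - w‖ := by
      intro c w hw
      by_cases hc : c = 0
      · simp [hc]
      have hxne : ((‖(x : X)‖ : ℝ) : ℂ) ≠ 0 := by exact_mod_cast hn.ne'
      have h1 := hx' ((((‖(x : X)‖ : ℝ) : ℂ) * c⁻¹) • w) (W.smul_mem _ hw)
      have h2 : c • v - w = (c * ((‖(x : X)‖ : ℝ) : ℂ)⁻¹) •
          ((x : X) - (((‖(x : X)‖ : ℝ) : ℂ) * c⁻¹) • w) := by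
        rw [smul_sub, hv, smul_smul, smul_smul]
        congr 1
        · push_cast; rfl
        · rw [show c * ((‖(x : X)‖ : ℝ) : ℂ)⁻¹ * (((‖(x : X)‖ : ℝ) : ℂ) * c⁻¹) = 1 by
            field_simp, one_smul]
      rw [h2, norm_smul, norm_mul, norm_inv, Complex.norm_real, norm_norm]
      calc ‖c‖ = 2 * (‖c‖ * ‖(x:X)‖⁻¹ * (1/2 * ‖(x:X)‖)) := by field_simp
        _ ≤ _ := by gcongr
    refine ⟨Fin.cons v u, ?_, ?_, ?_⟩
    · intro i
      refine Fin.cases ?_ (fun i => ?_) i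
      · simpa using hvY
      · simpa using huY i
    · intro i
      refine Fin.cases ?_ (fun i => ?_) i
      · simp [hvn]
      · simpa using hu1 i
    · intro c z hz i
      rw [Fin.sum_univ_succ]
      simp only [Fin.cons_zero, Fin.cons_succ]
      set s := ∑ i : Fin k, c i.succ • u i with hs
      have hsW : z - s ∈ W := W.sub_mem (Submodule.mem_sup_left hz) (Submodule.mem_sup_right
        (Submodule.sum_mem _ fun i _ => Submodule.smul_mem _ _ (Submodule.subset_span ⟨i, rfl⟩)))
      have h0 : ‖c 0‖ ≤ 2 * ‖c 0 • v + s - z‖ := by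
        have := hvc (c 0) _ hsW
        rwa [show c 0 • v - (z - s) = c 0 • v + s - z by abel] at this
      have h3 : (1:ℝ) ≤ 3 ^ k := one_le_pow₀ (by norm_num)
      have hnn := norm_nonneg (c 0 • v + s - z)
      refine Fin.cases ?_ (fun i => ?_) i
      · rw [pow_succ]; nlinarith
      · have h4 := huc (fun i => c i.succ) z hz i
        simp only [← hs] at h4
        have h5 : ‖s - z‖ ≤ 3 * ‖c 0 • v + s - z‖ := by
          have : s - z = (c 0 • v + s - z) - c 0 • v := by abel
          calc ‖s - z‖ ≤ ‖c 0 • v + s - z‖ + ‖c 0 • v‖ := by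
                conv_lhs => rw [this]
                exact norm_sub_le _ _
            _ ≤ _ := by rw [norm_smul, hvn]; linarith
        calc ‖c i.succ‖ ≤ 3 ^ k * ‖s - z‖ := h4
          _ ≤ 3 ^ k * (3 * ‖c 0 • v + s - z‖) := by gcongr
          _ = _ := by ring

lemma decomp {X : Type*} [NormedAddCommGroup X] [NormedSpace ℂ X]
    [CompleteSpace X] (M N Y : Submodule ℂ X)
    (hM : IsClosed (M : Set X)) (hN : IsClosed (N : Set X)) (hY : IsClosed (Y : Set X))
    (hMN : IsClosed ((M ⊔ N : Submodule ℂ X) : Set X))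
    (hfin : QuotFin (M ⊔ N) Y) :
    ∃ (Q : X →L[ℂ] (Fin (quotFinrank (M ⊔ N) Y) → ℂ)) (K : ℝ), 0 < K ∧ ∀ y ∈ Y,
      ∃ m ∈ M, ∃ n ∈ N, ‖m‖ ≤ K * ‖y‖ ∧ ‖n‖ ≤ K * ‖y‖ ∧ ‖y - (m + n)‖ ≤ K * ‖Q y‖ := by
  have : CompleteSpace M := hM.completeSpace_coe
  have : CompleteSpace N := hN.completeSpace_coe
  have : CompleteSpace Y := hY.completeSpace_coe
  have : CompleteSpace (M ⊔ N : Submodule ℂ X) := hMN.completeSpace_coe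
  set A : Submodule ℂ Y := (M ⊔ N).comap Y.subtype with hA
  have hAc : IsClosed (A : Set Y) := hMN.preimage continuous_subtype_val
  have : FiniteDimensional ℂ (Y ⧸ A) := hfin
  have hAc' : IsClosed (A.toAddSubgroup : Set Y) := hAc
  let e : (Y ⧸ A) ≃L[ℂ] (Fin (quotFinrank (M ⊔ N) Y) → ℂ) :=
    ContinuousLinearEquiv.ofFinrankEq (by rw [Module.finrank_fin_fun]; rfl)
  let q : Y →L[ℂ] (Fin (quotFinrank (M ⊔ N) Y) → ℂ) :=
    (e : (Y ⧸ A) →L[ℂ] _).comp A.mkQL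
  have hqs : Function.Surjective q := e.surjective.comp (Submodule.mkQ_surjective A)
  have hqk : ∀ y : Y, q y = 0 → (y : X) ∈ M ⊔ N := by
    intro y hy
    have h1 : e (A.mkQ y) = 0 := hy
    rw [map_eq_zero_iff e e.injective] at h1
    exact (Submodule.Quotient.mk_eq_zero A).1 h1
  obtain ⟨Q, hQ⟩ := q.exist_extension_of_finiteDimensional_range
  obtain ⟨C, hC, hCq⟩ := q.exists_preimage_norm_le hqs
  let T : (M × N) →L[ℂ] (M ⊔ N : Submodule ℂ X) :=
    ((M.subtypeL.comp (ContinuousLinearMap.fst ℂ M N)) +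
      (N.subtypeL.comp (ContinuousLinearMap.snd ℂ M N))).codRestrict _
      (fun p => Submodule.add_mem_sup p.1.2 p.2.2)
  have hT : Function.Surjective T := by
    rintro ⟨w, hw⟩
    obtain ⟨m, hm, n, hn, rfl⟩ := Submodule.mem_sup.1 hw
    exact ⟨(⟨m, hm⟩, ⟨n, hn⟩), rfl⟩
  obtain ⟨D, hD, hDT⟩ := T.exists_preimage_norm_le hT
  have hpos : 0 ≤ ‖Q‖ := norm_nonneg Q
  refine ⟨Q, D * (1 + C * ‖Q‖) + C, by positivity, ?_⟩
  intro y hy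
  have hQy : q ⟨y, hy⟩ = Q y := by rw [hQ]; rfl
  obtain ⟨r, hr, hrn⟩ := hCq (q ⟨y, hy⟩)
  have hmem : y - (r : X) ∈ M ⊔ N := hqk (⟨y, hy⟩ - r) (by rw [map_sub, hr, sub_self])
  obtain ⟨⟨m, n⟩, hmn, hmnn⟩ := hDT ⟨_, hmem⟩
  have hmn' : (m : X) + n = y - r := congrArg Subtype.val hmn
  have hrn' : ‖(r : X)‖ ≤ C * ‖Q y‖ := by rw [← hQy]; exact hrn
  have hQn : ‖Q y‖ ≤ ‖Q‖ * ‖y‖ := Q.le_opNorm y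
  have hyr : ‖y - (r : X)‖ ≤ (1 + C * ‖Q‖) * ‖y‖ := by
    calc ‖y - (r : X)‖ ≤ ‖y‖ + ‖(r : X)‖ := norm_sub_le _ _
      _ ≤ ‖y‖ + C * (‖Q‖ * ‖y‖) := by gcongr; exact hrn'.trans (by gcongr)
      _ = _ := by ring
  have hb : ‖(m, n)‖ ≤ (D * (1 + C * ‖Q‖) + C) * ‖y‖ := by
    calc ‖(m, n)‖ ≤ D * ‖y - (r : X)‖ := hmnn
      _ ≤ D * ((1 + C * ‖Q‖) * ‖y‖) := by gcongr
      _ ≤ _ := by have := mul_nonneg hC.le (norm_nonneg y); nlinarith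
  refine ⟨m, m.2, n, n.2, (norm_fst_le (m, n)).trans hb, (norm_snd_le (m, n)).trans hb, ?_⟩
  rw [hmn', sub_sub_cancel]
  refine hrn'.trans ?_
  have : 0 ≤ D * (1 + C * ‖Q‖) * ‖Q y‖ := by positivity
  linarith

lemma approx' {X : Type*} [NormedAddCommGroup X] [NormedSpace ℂ X]
    {F : Type*} [NormedAddCommGroup F] [NormedSpace ℂ F]
    (M N Y M' N' Y' : Submodule ℂ X) (Q : X →L[ℂ] F) (K : ℝ) (hK : 0 < K)
    (h : ∀ y ∈ Y, ∃ m ∈ M, ∃ n ∈ N, ‖m‖ ≤ K * ‖y‖ ∧ ‖n‖ ≤ K * ‖y‖ ∧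
      ‖y - (m + n)‖ ≤ K * ‖Q y‖) (ε : ℝ) (hε : 0 < ε) (hε1 : ε ≤ 1)
    (h1 : gapSub M M' < ε) (h2 : gapSub N N' < ε) (h3 : gapSub Y' Y < ε) :
    ∀ y ∈ Y', ∃ m ∈ M', ∃ n ∈ N', ‖m‖ ≤ 4 * K * ‖y‖ ∧ ‖n‖ ≤ 4 * K * ‖y‖ ∧
      ‖y - (m + n)‖ ≤ ε * (1 + K * ‖Q‖ + 4 * K) * ‖y‖ + K * ‖Q y‖ := by
  intro y' hy'
  obtain ⟨y, hy, hyy⟩ := gap_approx Y' Y h3 y' hy'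
  obtain ⟨m, hm, n, hn, hmK, hnK, hr⟩ := h y hy
  obtain ⟨m', hm', hmm⟩ := gap_approx M M' h1 m hm
  obtain ⟨n', hn', hnn⟩ := gap_approx N N' h2 n hn
  have hy0 := norm_nonneg y'
  have hyn : ‖y‖ ≤ 2 * ‖y'‖ := by
    have : ‖y‖ ≤ ‖y'‖ + ‖y' - y‖ := by
      have := norm_sub_le y' (y' - y); rwa [sub_sub_cancel] at this
    nlinarith
  have hm2 : ‖m‖ ≤ 2 * K * ‖y'‖ := by nlinarith
  have hn2 : ‖n‖ ≤ 2 * K * ‖y'‖ := by nlinarith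
  have hm3 : ‖m - m'‖ ≤ ε * (2 * K * ‖y'‖) := hmm.trans (by gcongr)
  have hn3 : ‖n - n'‖ ≤ ε * (2 * K * ‖y'‖) := hnn.trans (by gcongr)
  have hp : 0 ≤ 2 * K * ‖y'‖ := by positivity
  refine ⟨m', hm', n', hn', ?_, ?_, ?_⟩
  · have := norm_sub_le m (m - m'); rw [sub_sub_cancel] at this
    nlinarith
  · have := norm_sub_le n (n - n'); rw [sub_sub_cancel] at this
    nlinarith
  · have hQ : ‖Q y‖ ≤ ‖Q y'‖ + ‖Q‖ * (ε * ‖y'‖) := by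
      have := norm_sub_le (Q y') (Q (y' - y))
      rw [← map_sub, sub_sub_cancel] at this
      have h5 := Q.le_opNorm (y' - y)
      have h6 : ‖Q‖ * ‖y' - y‖ ≤ ‖Q‖ * (ε * ‖y'‖) := by gcongr
      linarith
    have h7 : K * ‖Q y‖ ≤ K * (‖Q y'‖ + ‖Q‖ * (ε * ‖y'‖)) := by gcongr
    have h8 : y' - (m' + n') = (y' - y) + (y - (m + n)) + (m - m') + (n - n') := by abel
    have h9 : ‖y' - (m' + n')‖ ≤ ‖y' - y‖ + ‖y - (m + n)‖ + ‖m - m'‖ + ‖n - n'‖ := by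
      rw [h8]; exact norm_add₄_le
    calc _ ≤ _ := h9
      _ ≤ ε * ‖y'‖ + K * (‖Q y'‖ + ‖Q‖ * (ε * ‖y'‖)) + ε * (2 * K * ‖y'‖) + ε * (2 * K * ‖y'‖) := by
        linarith
      _ = _ := by ring

lemma closed_of_approx {X : Type*} [NormedAddCommGroup X] [NormedSpace ℂ X] [CompleteSpace X]
    {F : Type*} [NormedAddCommGroup F] [NormedSpace ℂ F] [ProperSpace F]
    (M N Y : Submodule ℂ X) (Q : X →L[ℂ] F)
    (hM : IsClosed (M : Set X)) (hN : IsClosed (N : Set X)) (hY : IsClosed (Y : Set X))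
    (hle : M ⊔ N ≤ Y) (K L θ : ℝ) (hK : 0 < K) (hθ0 : 0 ≤ θ) (hθ : θ * 12 ≤ 1)
    (h : ∀ y ∈ Y, ∃ m ∈ M, ∃ n ∈ N, ‖m‖ ≤ L * ‖y‖ ∧ ‖n‖ ≤ L * ‖y‖ ∧
      ‖y - (m + n)‖ ≤ θ * ‖y‖ + K * ‖Q y‖) :
    IsClosed ((M ⊔ N : Submodule ℂ X) : Set X) := by
  set W := (M ⊔ N).topologicalClosure with hWd
  have hZW : M ⊔ N ≤ W := Submodule.le_topologicalClosure _
  have hWY : W ≤ Y := Submodule.topologicalClosure_minimal _ hle hY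
  suffices hmain : W ≤ M ⊔ N by
    have : W = M ⊔ N := le_antisymm hmain hZW
    rw [← this]
    exact Submodule.isClosed_topologicalClosure _
  set η : ℝ := 1 / (8 * K) with hη
  have hηpos : 0 < η := by positivity
  set S : Set F := Q '' {z | z ∈ M ⊔ N ∧ ‖z‖ ≤ 2} with hS
  have hStb : TotallyBounded S := by
    apply (isCompact_closedBall (0 : F) (‖Q‖ * 2)).totallyBounded.subset
    rintro _ ⟨z, ⟨_, hz⟩, rfl⟩
    rw [mem_closedBall_zero_iff]
    exact (Q.le_opNorm z).trans (by gcongr)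
  obtain ⟨t, htS, htf, hcov⟩ := hStb.exists_subset (Metric.dist_mem_uniformity hηpos)
  have hpre : ∀ s : F, ∃ m n : X, s ∈ t → m ∈ M ∧ n ∈ N ∧ ‖m + n‖ ≤ 2 ∧ Q (m + n) = s := by
    intro s
    by_cases hs : s ∈ t
    · obtain ⟨z, ⟨hz, hz2⟩, hzs⟩ := htS hs
      obtain ⟨m, hm, n, hn, rfl⟩ := Submodule.mem_sup.1 hz
      exact ⟨m, n, fun _ => ⟨hm, hn, hz2, hzs⟩⟩
    · exact ⟨0, 0, fun h => absurd h hs⟩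
  choose m n hmn using hpre
  obtain ⟨R, hR⟩ := (htf.image (fun s => ‖m s‖ + ‖n s‖)).bddAbove
  have hunit : ∀ y ∈ W, ‖y‖ = 1 → ∃ a ∈ M, ∃ b ∈ N, ‖a‖ ≤ R + |L| * 3 ∧ ‖b‖ ≤ R + |L| * 3 ∧
      ‖y - (a + b)‖ ≤ 1/2 := by
    intro y hy hy1
    have hδ : 0 < min 1 (η / (‖Q‖ + 1)) := by positivity
    obtain ⟨z, hz, hyz⟩ := Metric.mem_closure_iff.1 hy _ hδ
    rw [dist_eq_norm] at hyz
    have hyz1 : ‖y - z‖ ≤ 1 := hyz.le.trans (min_le_left _ _)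
    have hyz2 : ‖y - z‖ ≤ η / (‖Q‖ + 1) := hyz.le.trans (min_le_right _ _)
    have hz2 : ‖z‖ ≤ 2 := by
      have := norm_sub_le y (y - z); rw [sub_sub_cancel] at this; linarith
    have hQz : Q z ∈ S := ⟨z, ⟨hz, hz2⟩, rfl⟩
    obtain ⟨s, hs, hzs⟩ := Set.mem_iUnion₂.1 (hcov hQz)
    have hzs' : ‖Q z - s‖ < η := by rw [← dist_eq_norm]; exact hzs
    obtain ⟨hmM, hnN, hmn2, hmns⟩ := hmn s hs
    have hRs : ‖m s‖ + ‖n s‖ ≤ R := hR ⟨s, hs, rfl⟩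
    set w := y - (m s + n s) with hw
    have hwY : w ∈ Y := hWY (W.sub_mem hy (hZW (Submodule.add_mem_sup hmM hnN)))
    have hwn : ‖w‖ ≤ 3 := (norm_sub_le _ _).trans (by linarith)
    have hQw : ‖Q w‖ ≤ 2 * η := by
      have e : Q w = Q (y - z) + (Q z - s) := by rw [hw, map_sub, map_sub, hmns]; abel
      have h1 : ‖Q (y - z)‖ ≤ η := by
        calc ‖Q (y - z)‖ ≤ ‖Q‖ * ‖y - z‖ := Q.le_opNorm _
          _ ≤ (‖Q‖ + 1) * (η / (‖Q‖ + 1)) := by gcongr; linarith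
          _ = η := by field_simp
      rw [e]
      exact (norm_add_le _ _).trans (by linarith)
    obtain ⟨a, ha, b, hb, han, hbn, hab⟩ := h w hwY
    have hL : L * ‖w‖ ≤ |L| * 3 := mul_le_mul (le_abs_self _) hwn (norm_nonneg _) (abs_nonneg _)
    refine ⟨m s + a, M.add_mem hmM ha, n s + b, N.add_mem hnN hb, ?_, ?_, ?_⟩
    · have := norm_add_le (m s) a
      have := norm_nonneg (n s)
      linarith
    · have := norm_add_le (n s) b
      have := norm_nonneg (m s)
      linarith
    · have e : y - (m s + a + (n s + b)) = w - (a + b) := by rw [hw]; abel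
      rw [e]
      have h1 : K * ‖Q w‖ ≤ K * (2 * η) := by gcongr
      have h2 : K * (2 * η) = 1/4 := by rw [hη]; field_simp; norm_num
      have h3 : θ * ‖w‖ ≤ θ * 3 := by gcongr
      linarith
  refine le_sup_of_approx M N W hM hN hZW (R + |L| * 3) ?_
  intro y hy
  by_cases h0 : y = 0
  · exact ⟨0, M.zero_mem, 0, N.zero_mem, by simp [h0]⟩
  have hn : 0 < ‖y‖ := norm_pos_iff.mpr h0
  set v : X := ((‖y‖⁻¹ : ℝ) : ℂ) • y with hv
  have hvn : ‖v‖ = 1 := by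
    rw [hv, norm_smul, Complex.norm_real, norm_inv, norm_norm]
    exact inv_mul_cancel₀ hn.ne'
  have hyv : y = ((‖y‖ : ℝ) : ℂ) • v := by
    rw [hv, smul_smul, ← Complex.ofReal_mul, mul_inv_cancel₀ hn.ne']; simp
  obtain ⟨a, ha, b, hb, han, hbn, hab⟩ := hunit v (W.smul_mem _ hy) hvn
  have hsm : ∀ x : X, ‖((‖y‖ : ℝ) : ℂ) • x‖ = ‖y‖ * ‖x‖ := by
    intro x; rw [norm_smul, Complex.norm_real, norm_norm]
  refine ⟨((‖y‖ : ℝ) : ℂ) • a, M.smul_mem _ ha, ((‖y‖ : ℝ) : ℂ) • b, N.smul_mem _ hb, ?_, ?_, ?_⟩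
  · rw [hsm, mul_comm]; gcongr
  · rw [hsm, mul_comm]; gcongr
  · have e : y - (((‖y‖ : ℝ) : ℂ) • a + ((‖y‖ : ℝ) : ℂ) • b)
        = ((‖y‖ : ℝ) : ℂ) • (v - (a + b)) := by
      rw [smul_sub, smul_add, ← hyv]
    rw [e, hsm, mul_comm]; gcongr

/-- Stability of the codimension of the sum: if
`Y₁ ⊆ M ∩ N ⊆ M + N ⊆ Y₂` with all subspaces closed, `M + N` closed and
`dim (Y₂/(M+N)) < ∞`, then for all closed `M', N', Y₂'` with `M' + N' ⊆ Y₂'`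
and sufficiently small `δ(M,M')`, `δ(N,N')`, `δ(Y₂',Y₂)`, the subspace
`M' + N'` is closed and `dim (Y₂'/(M'+N')) ≤ dim (Y₂/(M+N))`. -/
theorem stable_sum_codim {X : Type*} [NormedAddCommGroup X] [NormedSpace ℂ X]
    [CompleteSpace X] (Y₁ M N Y₂ : Submodule ℂ X)
    (hY₁c : IsClosed (Y₁ : Set X)) (hMc : IsClosed (M : Set X))
    (hNc : IsClosed (N : Set X)) (hY₂c : IsClosed (Y₂ : Set X))
    (hMNc : IsClosed ((M ⊔ N : Submodule ℂ X) : Set X))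
    (h₁ : Y₁ ≤ M ⊓ N) (h₂ : M ⊔ N ≤ Y₂)
    (hfin : QuotFin (M ⊔ N) Y₂) :
    ∃ ε > (0 : ℝ), ∀ M' N' Y₂' : Submodule ℂ X,
      IsClosed (M' : Set X) → IsClosed (N' : Set X) → IsClosed (Y₂' : Set X) →
      M' ⊔ N' ≤ Y₂' →
      gapSub M M' < ε → gapSub N N' < ε → gapSub Y₂' Y₂ < ε →
      IsClosed ((M' ⊔ N' : Submodule ℂ X) : Set X) ∧
        quotRank (M' ⊔ N') Y₂' ≤ quotRank (M ⊔ N) Y₂ := by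
  have hdecomp := decomp M N Y₂ hMc hNc hY₂c hMNc hfin
  generalize hd : quotFinrank (M ⊔ N) Y₂ = d at hdecomp
  obtain ⟨Q, K, hK, hdec⟩ := hdecomp
  set A : ℝ := 1 + K * ‖Q‖ + 4 * K with hA
  have hApos : 0 < A := by positivity
  set B : ℝ := 3 ^ (d + 1) * (d + 1) + 12 with hB
  have hB0 : (0:ℝ) ≤ 3 ^ (d + 1) * (d + 1) := by positivity
  have hBpos : 0 < B := by positivity
  have hεpos : 0 < min 1 (1 / (A * B)) := by positivity
  refine ⟨min 1 (1 / (A * B)), hεpos, ?_⟩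
  intro M' N' Y' hM' hN' hY' hle g1 g2 g3
  have happ := approx' M N Y₂ M' N' Y' Q K hK hdec _ hεpos (min_le_left _ _) g1 g2 g3
  rw [← hA] at happ
  set θ := min 1 (1 / (A * B)) * A with hθ
  have hθB : θ * B ≤ 1 := by
    have : min 1 (1 / (A * B)) ≤ 1 / (A * B) := min_le_right _ _
    rw [le_div_iff₀ (by positivity)] at this
    rw [hθ]; linarith
  have hθ0 : 0 < θ := by positivity
  have hcl : IsClosed ((M' ⊔ N' : Submodule ℂ X) : Set X) := by
    refine closed_of_approx M' N' Y' Q hM' hN' hY' hle K (4 * K) θ hK hθ0.le ?_ happ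
    have : θ * 12 ≤ θ * B := by gcongr; linarith
    linarith
  refine ⟨hcl, ?_⟩
  have hfd : FiniteDimensional ℂ (↥Y₂ ⧸ (M ⊔ N).comap Y₂.subtype) := hfin
  have hrank : quotRank (M ⊔ N) Y₂ = (d : Cardinal) := by
    rw [← hd]; exact (Module.finrank_eq_rank ℂ _).symm
  rw [hrank]
  by_contra hlt
  rw [not_le] at hlt
  have hk : ((d + 1 : ℕ) : Cardinal) ≤ quotRank (M' ⊔ N') Y' := by
    have := Order.succ_le_of_lt hlt
    rw [Cardinal.succ_natCast] at this
    exact_mod_cast this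
  obtain ⟨u, huY, hu1, huc⟩ := riesz_family (M' ⊔ N') Y' hcl hle (d + 1) hk
  let φ : (Fin (d + 1) → ℂ) →ₗ[ℂ] (Fin d → ℂ) :=
    (Q : X →ₗ[ℂ] (Fin d → ℂ)) ∘ₗ Fintype.linearCombination ℂ u
  have hker : LinearMap.ker φ ≠ ⊥ := LinearMap.ker_ne_bot_of_finrank_lt (by simp)
  obtain ⟨c, hc, hc0⟩ := (Submodule.ne_bot_iff _).1 hker
  set y := ∑ i, c i • u i with hy
  have hQy : Q y = 0 := by
    have : φ c = 0 := hc
    simpa [φ, hy, Fintype.linearCombination_apply] using this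
  have hyY : y ∈ Y' := Y'.sum_mem fun i _ => Y'.smul_mem _ (huY i)
  have hyn : ‖y‖ ≤ (d + 1) * ‖c‖ := by
    calc ‖y‖ ≤ ∑ i, ‖c i • u i‖ := norm_sum_le _ _
      _ ≤ ∑ i : Fin (d + 1), ‖c‖ := by
        apply Finset.sum_le_sum
        intro i _
        rw [norm_smul]
        calc ‖c i‖ * ‖u i‖ ≤ ‖c‖ * 1 := by
              gcongr
              · exact norm_le_pi_norm c i
              · exact hu1 i
          _ = _ := mul_one _
      _ = _ := by simp
  obtain ⟨m, hm, n, hn, -, -, hr⟩ := happ y hyY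
  rw [hQy, norm_zero, mul_zero, add_zero] at hr
  have hcn : ‖c‖ ≤ 3 ^ (d + 1) * ‖y - (m + n)‖ :=
    (pi_norm_le_iff_of_nonneg (by positivity)).2
      (huc c (m + n) (Submodule.add_mem_sup hm hn))
  have hcpos : 0 < ‖c‖ := norm_pos_iff.2 hc0
  have : ‖c‖ ≤ (θ * (3 ^ (d + 1) * (d + 1))) * ‖c‖ := by
    calc ‖c‖ ≤ 3 ^ (d + 1) * ‖y - (m + n)‖ := hcn
      _ ≤ 3 ^ (d + 1) * (θ * ((d + 1) * ‖c‖)) := by gcongr; exact hr.trans (by gcongr)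
      _ = _ := by ring
  have h2 : θ * (3 ^ (d + 1) * (d + 1)) < 1 := by
    have : θ * B = θ * (3 ^ (d + 1) * (d + 1)) + θ * 12 := by rw [hB]; ring
    linarith
  nlinarith
end

section
/- Let X be a Banach space and let Y₁, M, N, Y₂ be closed linear subspaces of X such that M+N is closed and Y₁ ⊆ M∩N ⊆ M+N ⊆ Y₂. Assume dim((M∩N)/Y₁) is finite. Then there exists ε > 0 such that for every triple (Y₁′, M′, N′) of closed linear subspaces of X with Y₁′ ⊆ M′∩N′ and δ(Y₁,Y₁′) < ε, δ(M′,M) < ε, δ(N′,N) < ε, the subspace M′+N′ is closed and dim((M′∩N′)/Y₁′) ≤ dim((M∩N)/Y₁). -/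
open scoped Classical

theorem aux_proj {V : Type*} [NormedAddCommGroup V] [NormedSpace ℂ V] (n : ℕ) (v : Fin n → V) :
    ∃ P : V →L[ℂ] V, (∀ x, P x ∈ Submodule.span ℂ (Set.range v)) ∧
      (∀ x ∈ Submodule.span ℂ (Set.range v), P x = x) ∧
      ∀ x, ‖P x‖ ≤ (2 ^ n - 1) * ‖x‖ := by
  induction n with
  | zero =>
    refine ⟨0, by simp, ?_, by simp⟩
    intro x hx
    simp at hx
    simp [hx]
  | succ n ih =>
    obtain ⟨P, hP1, hP2, hP3⟩ := ih (Fin.tail v)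
    set S := Submodule.span ℂ (Set.range (Fin.tail v)) with hS
    have hspan : Submodule.span ℂ (Set.range v) = Submodule.span ℂ {v 0} ⊔ S := by
      rw [← Fin.cons_self_tail v, Fin.range_cons, Submodule.span_insert]
      simp [hS]
    set f := v 0 - P (v 0) with hf
    obtain ⟨g, hg1, hg2⟩ := exists_dual_vector'' ℂ f
    have hfm : f ∈ Submodule.span ℂ {v 0} ⊔ S := by
      apply Submodule.sub_mem
      · exact Submodule.mem_sup_left (Submodule.mem_span_singleton_self _)
      · exact Submodule.mem_sup_right (hP1 _)
    let Q : V →L[ℂ] V := P + (((‖f‖ : ℂ)⁻¹ • g) ∘L (ContinuousLinearMap.id ℂ V - P)).smulRight f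
    have hQ : ∀ x, Q x = P x + ((‖f‖ : ℂ)⁻¹ * g (x - P x)) • f := by
      intro x
      simp [Q, mul_sub]
    refine ⟨Q, ?_, ?_, ?_⟩
    · intro x
      rw [hspan, hQ]
      exact Submodule.add_mem _ (Submodule.mem_sup_right (hP1 _)) (Submodule.smul_mem _ _ hfm)
    · intro x hx
      rw [hspan] at hx
      obtain ⟨y, hy, z, hz, rfl⟩ := Submodule.mem_sup.1 hx
      obtain ⟨c, rfl⟩ := Submodule.mem_span_singleton.1 hy
      have h0 : Q (v 0) = v 0 := by
        rw [hQ, ← hf, hg2]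
        by_cases h : f = 0
        · rw [h, smul_zero, add_zero]
          exact (sub_eq_zero.1 (hf.symm.trans h)).symm
        · have : ((‖f‖ : ℝ) : ℂ) ≠ 0 := by simpa using h
          have h2 : (‖f‖ : ℂ)⁻¹ * ((‖f‖ : ℝ) : ℂ) = 1 := inv_mul_cancel₀ this
          erw [h2]
          rw [one_smul, hf]
          abel
      have hz' : Q z = z := by
        rw [hQ, hP2 z hz]; simp
      rw [map_add, map_smul, h0, hz']
    · intro x
      rw [hQ]
      have h1 : ‖x - P x‖ ≤ 2 ^ n * ‖x‖ := by
        have := norm_sub_le x (P x)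
        have := hP3 x
        nlinarith
      have h2 : ‖g (x - P x)‖ ≤ 2 ^ n * ‖x‖ := by
        have := g.le_of_opNorm_le hg1 (x - P x)
        linarith
      have h3 : ‖((‖f‖ : ℂ)⁻¹ * g (x - P x)) • f‖ ≤ 2 ^ n * ‖x‖ := by
        rw [norm_smul, norm_mul, norm_inv]
        have : ‖(‖f‖ : ℂ)‖ = ‖f‖ := by simp
        rw [this]
        by_cases h : f = 0
        · rw [h]; simp
        · have : ‖f‖ ≠ 0 := by simpa using h
          calc ‖f‖⁻¹ * ‖g (x - P x)‖ * ‖f‖ = ‖g (x - P x)‖ := by field_simp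
            _ ≤ _ := h2
      calc _ ≤ _ := norm_add_le _ _
        _ ≤ (2 ^ n - 1) * ‖x‖ + 2 ^ n * ‖x‖ := add_le_add (hP3 x) h3
        _ = _ := by ring

theorem aux_closed {V : Type*} [NormedAddCommGroup V] [NormedSpace ℂ V] [CompleteSpace V]
    (A B : Submodule ℂ V) (hA : IsClosed (A : Set V)) (hB : IsClosed (B : Set V)) (c : ℝ)
    (hc : 0 ≤ c) (h : ∀ a ∈ A, ∀ b ∈ B, ‖a‖ ≤ c * ‖a - b‖) :
    IsClosed ((A ⊔ B : Submodule ℂ V) : Set V) := by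
  have := hA.completeSpace_coe
  have := hB.completeSpace_coe
  let T : (A × B) →L[ℂ] V := A.subtypeL.coprod (-B.subtypeL)
  have hT : ∀ p, T p = (p.1 : V) - p.2 := by intro p; simp [T, sub_eq_add_neg]
  have hr : ((A ⊔ B : Submodule ℂ V) : Set V) = Set.range T := by
    ext x
    simp only [SetLike.mem_coe, Set.mem_range, Submodule.mem_sup]
    constructor
    · rintro ⟨a, ha, b, hb, rfl⟩
      exact ⟨(⟨a, ha⟩, ⟨-b, B.neg_mem hb⟩), by rw [hT]; simp⟩
    · rintro ⟨⟨a, b⟩, rfl⟩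
      exact ⟨a, a.2, -b, B.neg_mem b.2, by rw [hT]; simp [sub_eq_add_neg]⟩
  rw [hr]
  have hal : AntilipschitzWith (⟨c + 1, by linarith⟩ : NNReal) T := by
    apply ContinuousLinearMap.antilipschitz_of_bound
    rintro ⟨a, b⟩
    rw [hT]
    have h1 := h a a.2 b b.2
    have h2 : ‖(b : V)‖ ≤ ‖(a : V)‖ + ‖(a : V) - b‖ := by
      have := norm_sub_le (a : V) ((a : V) - b)
      simpa using this
    have h3 := norm_nonneg ((a : V) - b)
    change max ‖(a : V)‖ ‖(b : V)‖ ≤ (c + 1) * ‖(a : V) - b‖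
    apply max_le <;> nlinarith
  exact hal.isClosed_range T.uniformContinuous

theorem aux_main {V : Type*} [NormedAddCommGroup V] [NormedSpace ℂ V] [CompleteSpace V]
    (A B : Submodule ℂ V) (hA : IsClosed (A : Set V)) (hB : IsClosed (B : Set V)) (n : ℕ)
    (v : Fin n → V) (c η : ℝ) (hc : 0 ≤ c) (hη : 2 ^ n * η ≤ 1 / 2)
    (h : ∀ a ∈ A, ∀ b ∈ B, ∃ f ∈ Submodule.span ℂ (Set.range v),
      ‖a - f‖ ≤ c * ‖a - b‖ + η * ‖a‖) :
    IsClosed ((A ⊔ B : Submodule ℂ V) : Set V) ∧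
      Module.rank ℂ (A ⊓ B : Submodule ℂ V) ≤ n := by
  obtain ⟨P, hP1, hP2, hP3⟩ := aux_proj n v
  set F := Submodule.span ℂ (Set.range v) with hF
  have hFfin : FiniteDimensional ℂ F := FiniteDimensional.span_of_finite ℂ (Set.finite_range v)
  have hFr : Module.rank ℂ F ≤ n := by
    rw [← Module.finrank_eq_rank]
    have := finrank_range_le_card (R := ℂ) v
    simp only [Fintype.card_fin] at this
    exact_mod_cast this
  have key : ∀ a ∈ A, P a = 0 → ∀ b ∈ B, ‖a‖ ≤ (2 * 2 ^ n * c) * ‖a - b‖ := by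
    intro a ha hPa b hb
    obtain ⟨f, hf, hab⟩ := h a ha b hb
    have h1 : f = P (f - a) := by rw [map_sub, hPa, hP2 f hf, sub_zero]
    have h2 : ‖f‖ ≤ (2 ^ n - 1) * ‖a - f‖ := by
      have := hP3 (f - a)
      rw [← h1, norm_sub_rev] at this
      exact this
    have h3 : ‖a‖ ≤ ‖a - f‖ + ‖f‖ := by
      have := norm_add_le (a - f) f
      simpa using this
    have h4 : ‖a‖ ≤ 2 ^ n * ‖a - f‖ := by linarith
    have h5 : (2 : ℝ) ^ n * ‖a - f‖ ≤ 2 ^ n * (c * ‖a - b‖ + η * ‖a‖) := by gcongr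
    have h6 : 2 ^ n * η * ‖a‖ ≤ 1 / 2 * ‖a‖ := by gcongr
    nlinarith
  let PF : V →ₗ[ℂ] F := P.toLinearMap.codRestrict F hP1
  have hPF : ∀ x, PF x = 0 ↔ P x = 0 := by
    intro x
    rw [Subtype.ext_iff]; rfl
  constructor
  · let A0 : Submodule ℂ V := A ⊓ P.ker
    have hA0 : IsClosed (A0 : Set V) := hA.inter P.isClosed_ker
    have h1 : IsClosed ((A0 ⊔ B : Submodule ℂ V) : Set V) := by
      apply aux_closed A0 B hA0 hB (2 * 2 ^ n * c) (by positivity)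
      intro a ha b hb
      exact key a ha.1 ha.2 b hb
    obtain ⟨G, hG⟩ := Submodule.exists_isCompl (A0.comap A.subtype)
    let G' := G.map A.subtype
    have hGA : A0 ⊔ G' = A := by
      have h2 : (A0.comap A.subtype ⊔ G).map A.subtype = A := by
        rw [hG.sup_eq_top]; simp
      rw [Submodule.map_sup, Submodule.map_comap_subtype] at h2
      rwa [inf_eq_right.2 (inf_le_left : A0 ≤ A)] at h2
    have hGf : FiniteDimensional ℂ G := by
      apply FiniteDimensional.of_injective ((PF ∘ₗ A.subtype) ∘ₗ G.subtype)
      rw [← LinearMap.ker_eq_bot, LinearMap.ker_eq_bot']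
      intro x hx
      have hx' : P ((x : A) : V) = 0 := (hPF _).1 hx
      have h3 : (x : A) ∈ A0.comap A.subtype ⊓ G := ⟨⟨(x : A).2, hx'⟩, x.2⟩
      rw [hG.inf_eq_bot] at h3
      exact Subtype.ext ((Submodule.mem_bot ℂ).1 h3)
    have : FiniteDimensional ℂ G' := inferInstance
    have h4 : A ⊔ B = (A0 ⊔ B) ⊔ G' := by
      rw [← hGA]
      ac_rfl
    rw [h4]
    exact Submodule.isClosed_sup_finiteDimensional _ _ h1
  · refine le_trans (LinearMap.rank_le_of_injective (PF ∘ₗ (A ⊓ B).subtype) ?_) hFr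
    rw [← LinearMap.ker_eq_bot, LinearMap.ker_eq_bot']
    intro x hx
    have hx' : P (x : V) = 0 := (hPF _).1 hx
    have := key x x.2.1 hx' x x.2.2
    simp at this
    exact this

theorem aux_open {V : Type*} [NormedAddCommGroup V] [NormedSpace ℂ V] [CompleteSpace V]
    (A B : Submodule ℂ V) (hA : IsClosed (A : Set V)) (hB : IsClosed (B : Set V))
    (hAB : IsClosed ((A ⊔ B : Submodule ℂ V) : Set V)) :
    ∃ D > (0 : ℝ), ∀ x ∈ A ⊔ B, ∃ a ∈ A, ∃ b ∈ B, x = a + b ∧ ‖a‖ ≤ D * ‖x‖ := by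
  have := hA.completeSpace_coe
  have := hB.completeSpace_coe
  have := hAB.completeSpace_coe
  let T0 : (A × B) →L[ℂ] V := A.subtypeL.coprod B.subtypeL
  have hT0 : ∀ p, T0 p = (p.1 : V) + p.2 := by intro p; simp [T0]
  let T : (A × B) →L[ℂ] (A ⊔ B : Submodule ℂ V) := T0.codRestrict (A ⊔ B) (by
    intro p
    rw [hT0]
    exact Submodule.add_mem_sup p.1.2 p.2.2)
  have hs : Function.Surjective T := by
    rintro ⟨x, hx⟩
    obtain ⟨a, ha, b, hb, rfl⟩ := Submodule.mem_sup.1 hx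
    exact ⟨(⟨a, ha⟩, ⟨b, hb⟩), Subtype.ext (hT0 _)⟩
  obtain ⟨D, hD, hh⟩ := T.exists_preimage_norm_le hs
  refine ⟨D, hD, fun x hx => ?_⟩
  obtain ⟨p, hp, hn⟩ := hh ⟨x, hx⟩
  refine ⟨p.1, p.1.2, p.2, p.2.2, ?_, ?_⟩
  · rw [← hT0]
    exact (congrArg Subtype.val hp).symm
  · exact (norm_fst_le p).trans hn

theorem aux_gap {X : Type*} [NormedAddCommGroup X] [NormedSpace ℂ X]
    (M N : Submodule ℂ X) (ε : ℝ) (h : gapSub M N < ε) (u : X) (hu : u ∈ M) :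
    ∃ m ∈ N, ‖u - m‖ ≤ ε * ‖u‖ := by
  by_cases h0 : u = 0
  · exact ⟨0, N.zero_mem, by simp [h0]⟩
  have hn : ‖u‖ ≠ 0 := by simpa using h0
  have hcn : (‖u‖ : ℂ) ≠ 0 := by exact_mod_cast hn
  have hlt : Metric.infDist ((‖u‖ : ℂ)⁻¹ • u) (N : Set X) < ε := by
    refine lt_of_le_of_lt (le_csSup ?_ ?_) h
    · refine ⟨1, ?_⟩
      rintro _ ⟨w, ⟨-, hw⟩, rfl⟩
      have := Metric.infDist_le_dist_of_mem (x := w) N.zero_mem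
      simpa [hw] using this
    · refine ⟨_, ⟨M.smul_mem _ hu, ?_⟩, rfl⟩
      rw [norm_smul, norm_inv]
      simp [hn]
  obtain ⟨m, hm, hd⟩ := (Metric.infDist_lt_iff ⟨0, N.zero_mem⟩).1 hlt
  refine ⟨(‖u‖ : ℂ) • m, N.smul_mem _ hm, ?_⟩
  have : u - (‖u‖ : ℂ) • m = (‖u‖ : ℂ) • ((‖u‖ : ℂ)⁻¹ • u - m) := by
    rw [smul_sub, smul_smul, mul_inv_cancel₀ hcn, one_smul]
  rw [this, norm_smul, ← dist_eq_norm]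
  have h1 : ‖(‖u‖ : ℂ)‖ = ‖u‖ := by simp
  rw [h1, mul_comm]
  gcongr

theorem aux_lift {X : Type*} [NormedAddCommGroup X] [NormedSpace ℂ X] (Y : Submodule ℂ X)
    [IsClosed (Y : Set X)] (a : X ⧸ Y) : ∃ u : X, Y.mkQ u = a ∧ ‖u‖ ≤ 2 * ‖a‖ := by
  by_cases h : a = 0
  · exact ⟨0, by simp [h], by simp⟩
  · obtain ⟨u, hu, hl⟩ := Submodule.Quotient.norm_mk_lt a (norm_pos_iff.2 h)
    exact ⟨u, hu, by linarith⟩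

theorem aux_map_closed {X : Type*} [NormedAddCommGroup X] [NormedSpace ℂ X] (Y M : Submodule ℂ X)
    (hYM : Y ≤ M) (hM : IsClosed (M : Set X)) : IsClosed ((M.map Y.mkQ : Submodule ℂ (X ⧸ Y)) :
      Set (X ⧸ Y)) := by
  rw [← Y.isQuotientMap_mkQ.isClosed_preimage]
  have : (Y.mkQ ⁻¹' ((M.map Y.mkQ : Submodule ℂ (X ⧸ Y)) : Set (X ⧸ Y))) = (M : Set X) := by
    have := Submodule.comap_map_mkQ Y M
    rw [sup_eq_right.2 hYM] at this
    exact congrArg (fun S : Submodule ℂ X => (S : Set X)) this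
  rw [this]
  exact hM

theorem aux_mem {X : Type*} [NormedAddCommGroup X] [NormedSpace ℂ X] (Y M : Submodule ℂ X)
    (hYM : Y ≤ M) (u : X) (h : Y.mkQ u ∈ M.map Y.mkQ) : u ∈ M := by
  have := Submodule.comap_map_mkQ Y M
  rw [sup_eq_right.2 hYM] at this
  rw [← this]
  exact h

/-- Stability of the relative dimension of the intersection:
if `Y₁ ⊆ M ∩ N ⊆ M + N ⊆ Y₂` with all subspaces closed, `M + N` closed and
`dim ((M ∩ N)/Y₁) < ∞`, then for all closed `Y₁', M', N'` with
`Y₁' ⊆ M' ∩ N'` and sufficiently small `δ(Y₁,Y₁')`, `δ(M',M)`, `δ(N',N)`, the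
subspace `M' + N'` is closed and `dim ((M' ∩ N')/Y₁') ≤ dim ((M ∩ N)/Y₁)`. -/
theorem stable_cap_dim {X : Type*} [NormedAddCommGroup X] [NormedSpace ℂ X]
    [CompleteSpace X] (Y₁ M N Y₂ : Submodule ℂ X)
    (hY₁c : IsClosed (Y₁ : Set X)) (hMc : IsClosed (M : Set X))
    (hNc : IsClosed (N : Set X)) (hY₂c : IsClosed (Y₂ : Set X))
    (hMNc : IsClosed ((M ⊔ N : Submodule ℂ X) : Set X))
    (h₁ : Y₁ ≤ M ⊓ N) (h₂ : M ⊔ N ≤ Y₂)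
    (hfin : QuotFin Y₁ (M ⊓ N)) :
    ∃ ε > (0 : ℝ), ∀ Y₁' M' N' : Submodule ℂ X,
      IsClosed (Y₁' : Set X) → IsClosed (M' : Set X) → IsClosed (N' : Set X) →
      Y₁' ≤ M' ⊓ N' →
      gapSub Y₁ Y₁' < ε → gapSub M' M < ε → gapSub N' N < ε →
      IsClosed ((M' ⊔ N' : Submodule ℂ X) : Set X) ∧
        quotRank Y₁' (M' ⊓ N') ≤ quotRank Y₁ (M ⊓ N) := by
  have hfin' : FiniteDimensional ℂ (↥(M ⊓ N) ⧸ Y₁.comap (M ⊓ N).subtype) := hfin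
  set n := Module.finrank ℂ (↥(M ⊓ N) ⧸ Y₁.comap (M ⊓ N).subtype) with hn
  have hrank : quotRank Y₁ (M ⊓ N) = n := (Module.finrank_eq_rank ℂ _).symm
  let b := Module.finBasis ℂ (↥(M ⊓ N) ⧸ Y₁.comap (M ⊓ N).subtype)
  choose w hw using fun i => Submodule.mkQ_surjective (Y₁.comap (M ⊓ N).subtype) (b i)
  let v : Fin n → X := fun i => (w i : X)
  set F := Submodule.span ℂ (Set.range v) with hF
  have hFfin : FiniteDimensional ℂ F := FiniteDimensional.span_of_finite ℂ (Set.finite_range v)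
  have hKle : M ⊓ N ≤ Y₁ ⊔ F := by
    intro k hk
    have h3 := b.sum_repr ((Y₁.comap (M ⊓ N).subtype).mkQ ⟨k, hk⟩)
    set cf := b.repr ((Y₁.comap (M ⊓ N).subtype).mkQ ⟨k, hk⟩)
    have h4 : (Y₁.comap (M ⊓ N).subtype).mkQ (⟨k, hk⟩ - ∑ i, cf i • w i) = 0 := by
      rw [map_sub, map_sum, ← h3]
      simp only [map_smul, hw, sub_self]
    rw [Submodule.mkQ_apply, Submodule.Quotient.mk_eq_zero] at h4
    have h5 : k - ∑ i, cf i • v i ∈ Y₁ := by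
      have : ((M ⊓ N).subtype (⟨k, hk⟩ - ∑ i, cf i • w i)) ∈ Y₁ := h4
      simpa [v] using this
    have h6 : ∑ i, cf i • v i ∈ F :=
      Submodule.sum_mem _ fun i _ => Submodule.smul_mem _ _ (Submodule.subset_span ⟨i, rfl⟩)
    have := Submodule.add_mem_sup h5 h6
    simpa using this
  obtain ⟨D, hD, hDh⟩ := aux_open M N hMc hNc hMNc
  obtain ⟨E, hE, hEh⟩ := aux_open Y₁ F hY₁c F.closed_of_finiteDimensional
    (Submodule.isClosed_sup_finiteDimensional _ _ hY₁c)
  set H : ℝ := 1 + 2 * E + 2 * D * (1 + E) with hH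
  have hH1 : 1 ≤ H := by
    have : 0 ≤ 2 * E + 2 * D * (1 + E) := by positivity
    linarith
  have h2n : (1 : ℝ) ≤ 2 ^ n := one_le_pow₀ (by norm_num)
  set ε : ℝ := 1 / (2 ^ n * 4 * H) with hε
  have hε0 : 0 < ε := by positivity
  have hε1 : ε ≤ 1 := by
    rw [hε, div_le_one (by positivity)]
    nlinarith
  refine ⟨ε, hε0, ?_⟩
  intro Y₁' M' N' hY' hM' hN' hle gY gM gN
  have := hY'
  have hYM : Y₁' ≤ M' := hle.trans inf_le_left
  have hYN : Y₁' ≤ N' := hle.trans inf_le_right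
  have est : ∀ u ∈ M', ∀ z ∈ N', ∃ y ∈ Y₁', ∃ f ∈ F,
      ‖u - (y + f)‖ ≤ H * (‖u - z‖ + ε * ‖u‖) := by
    intro u hu z hz
    obtain ⟨m, hm, hum⟩ := aux_gap _ _ _ gM u hu
    obtain ⟨p, hp, hzp⟩ := aux_gap _ _ _ gN z hz
    obtain ⟨s, hs, t, ht, hst, hsn⟩ := hDh (m - p)
      (Submodule.sub_mem _ (Submodule.mem_sup_left hm) (Submodule.mem_sup_right hp))
    have hk : m - s ∈ M ⊓ N := by
      refine ⟨M.sub_mem hm hs, ?_⟩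
      have : m - s = p + t := by
        rw [sub_eq_iff_eq_add] at hst ⊢
        rw [hst]; abel
      rw [this]
      exact N.add_mem hp ht
    obtain ⟨y, hy, f, hf, hyf, hyn⟩ := hEh (m - s) (hKle hk)
    obtain ⟨y', hy', hyy⟩ := aux_gap _ _ _ gY y hy
    refine ⟨y', hy', f, hf, ?_⟩
    have hz1 : ‖z‖ ≤ ‖u‖ + ‖u - z‖ := by
      have := norm_sub_le u (u - z)
      simpa using this
    have hmp : ‖m - p‖ ≤ 2 * ‖u - z‖ + 2 * (ε * ‖u‖) := by
      have e : m - p = (u - z) - (u - m) + (z - p) := by abel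
      have h7 := norm_add_le ((u - z) - (u - m)) (z - p)
      have h8 := norm_sub_le (u - z) (u - m)
      rw [← e] at h7
      have h9 : ε * ‖z‖ ≤ ε * (‖u‖ + ‖u - z‖) := by gcongr
      have h10 : ε * ‖u - z‖ ≤ 1 * ‖u - z‖ := by gcongr
      linarith
    set t' := ‖u - z‖ + ε * ‖u‖ with ht'
    have hs1 : ‖s‖ ≤ 2 * D * t' := by
      have : D * ‖m - p‖ ≤ D * (2 * ‖u - z‖ + 2 * (ε * ‖u‖)) := by gcongr
      rw [ht']
      linarith
    have hms : ‖m - s‖ ≤ 2 * ‖u‖ + 2 * D * t' := by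
      have e : m - s = u - (u - m) - s := by abel
      have h7 := norm_sub_le (u - (u - m)) s
      have h8 := norm_sub_le u (u - m)
      rw [← e] at h7
      have h10 : ε * ‖u‖ ≤ 1 * ‖u‖ := by gcongr
      linarith
    have hy1 : ‖y - y'‖ ≤ E * (2 * (ε * ‖u‖) + 2 * D * t') := by
      have h7 : ε * ‖y‖ ≤ ε * (E * (2 * ‖u‖ + 2 * D * t')) := by
        have : E * ‖m - s‖ ≤ E * (2 * ‖u‖ + 2 * D * t') := by gcongr
        gcongr
        linarith
      have ht0 : 0 ≤ t' := by positivity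
      have h8 : ε * (E * (2 * D * t')) ≤ 1 * (E * (2 * D * t')) := by gcongr
      linarith
    have hfinal : ‖u - (y' + f)‖ ≤ ‖u - m‖ + ‖s‖ + ‖y - y'‖ := by
      have hm2 : m = y + f + s := by rw [← hyf]; abel
      have e : u - (y' + f) = (u - m) + s + (y - y') := by rw [hm2]; abel
      rw [e]
      exact norm_add₃_le
    have ht1 : ε * ‖u‖ ≤ t' := by
      rw [ht']; linarith [norm_nonneg (u - z)]
    have h11 : E * (2 * (ε * ‖u‖) + 2 * D * t') ≤ E * (2 * t' + 2 * D * t') := by gcongr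
    calc _ ≤ _ := hfinal
      _ ≤ t' + 2 * D * t' + E * (2 * t' + 2 * D * t') := by linarith
      _ = H * t' := by rw [hH]; ring
  have main := aux_main (M'.map Y₁'.mkQ) (N'.map Y₁'.mkQ) (aux_map_closed _ _ hYM hM')
    (aux_map_closed _ _ hYN hN') n (fun i => Y₁'.mkQ (v i)) (2 * H) (2 * H * ε) (by positivity)
    (by rw [hε]; field_simp; norm_num) (by
      intro a ha c hc
      obtain ⟨u, rfl, hun⟩ := aux_lift Y₁' a
      obtain ⟨d, hd, hdn⟩ := aux_lift Y₁' (Y₁'.mkQ u - c)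
      have hz : Y₁'.mkQ (u - d) = c := by rw [map_sub, hd]; abel
      have hu : u ∈ M' := aux_mem _ _ hYM u ha
      have hzN : u - d ∈ N' := aux_mem _ _ hYN _ (by rw [hz]; exact hc)
      obtain ⟨y, hy, f, hf, hest⟩ := est u hu (u - d) hzN
      refine ⟨Y₁'.mkQ f, ?_, ?_⟩
      · have : Set.range (fun i => Y₁'.mkQ (v i)) = Y₁'.mkQ '' Set.range v := by
          rw [← Set.range_comp]; rfl
        rw [this, ← Submodule.map_span]
        exact Submodule.mem_map_of_mem hf
      · have e : Y₁'.mkQ u - Y₁'.mkQ f = Y₁'.mkQ (u - (y + f)) := by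
          have : Y₁'.mkQ y = 0 := by simpa using hy
          rw [map_sub, map_add, this, zero_add]
        have h7 : ‖Y₁'.mkQ (u - (y + f))‖ ≤ ‖u - (y + f)‖ := Submodule.Quotient.norm_mk_le _ _
        rw [e]
        have e2 : u - (u - d) = d := by abel
        rw [e2] at hest
        have h8 : H * (‖d‖ + ε * ‖u‖) ≤
            H * (2 * ‖Y₁'.mkQ u - c‖ + ε * (2 * ‖Y₁'.mkQ u‖)) := by gcongr
        linarith)
  obtain ⟨hcl, hrk⟩ := main
  constructor
  · rw [← Submodule.map_sup] at hcl
    have := Submodule.comap_map_mkQ Y₁' (M' ⊔ N')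
    rw [sup_eq_right.2 (hYM.trans le_sup_left)] at this
    rw [← this]
    exact hcl.preimage Y₁'.isQuotientMap_mkQ.continuous
  · rw [hrank]
    refine le_trans ?_ hrk
    let L0 : ↥(M' ⊓ N') →ₗ[ℂ] ↥(M'.map Y₁'.mkQ ⊓ N'.map Y₁'.mkQ) :=
      (Y₁'.mkQ ∘ₗ (M' ⊓ N').subtype).codRestrict _ (fun x =>
        ⟨Submodule.mem_map_of_mem x.2.1, Submodule.mem_map_of_mem x.2.2⟩)
    have hker : L0.ker = Y₁'.comap (M' ⊓ N').subtype := by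
      ext x
      rw [LinearMap.mem_ker, Subtype.ext_iff]
      change Y₁'.mkQ (x : X) = 0 ↔ (x : X) ∈ Y₁'
      simp
    have hi : Function.Injective ((Y₁'.comap (M' ⊓ N').subtype).liftQ L0 hker.ge) := by
      rw [← LinearMap.ker_eq_bot]
      exact Submodule.ker_liftQ_eq_bot _ _ _ hker.le
    exact LinearMap.rank_le_of_injective _ hi
end

section
/- Let X be a Banach space and let (Y₁;M,N;Y₂) be a Fredholm tetrad of closed linear subspaces of X. Then there exists ε > 0 such that for every tetrad (Y₁′;M′,N′;Y₂′) of closed linear subspaces of X with Y₁′ ⊆ M′∩N′ ⊆ M′+N′ ⊆ Y₂′ and δ(Y₁′,Y₁) < ε, δ(M,M′) < ε, δ(N,N′) < ε, δ(Y₂′,Y₂) < ε, the subspace M′+N′ is closed, dim(Y₂′/(M′+N′)) is finite, and Index(Y₁′;M′,N′;Y₂′) ≥ Index(Y₁;M,N;Y₂) (the left-hand side taking values in ℤ∪{+∞}). -/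
open scoped Classical

/-- The dimension of the quotient `B / A` as an extended real:
the finrank if finite dimensional, `+∞` otherwise. -/
noncomputable def eQuotDim {X : Type*} [NormedAddCommGroup X] [NormedSpace ℂ X]
    (A B : Submodule ℂ X) : EReal :=
  if QuotFin A B then ((quotFinrank A B : ℝ) : EReal) else ⊤

/-- The index of a tetrad `(Y₁; M, N; Y₂)`:
`Index(Y₁; M, N; Y₂) = dim((M ∩ N)/Y₁) − dim(Y₂/(M + N))`, valued in `ℤ ∪ {±∞}`. -/
noncomputable def tetradIndex {X : Type*} [NormedAddCommGroup X] [NormedSpace ℂ X]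
    (Y₁ M N Y₂ : Submodule ℂ X) : EReal :=
  eQuotDim Y₁ (M ⊓ N) - eQuotDim (M ⊔ N) Y₂

def NearSub {X : Type*} [NormedAddCommGroup X] [NormedSpace ℂ X] (ε : ℝ)
    (A B : Submodule ℂ X) : Prop := ∀ u ∈ A, ∃ v ∈ B, ‖u - v‖ ≤ ε * ‖u‖

section
variable {X : Type*} [NormedAddCommGroup X] [NormedSpace ℂ X]

theorem NearSub.mono {ε η : ℝ} (h : ε ≤ η) {A B : Submodule ℂ X} (hA : NearSub ε A B) :
    NearSub η A B := fun u hu => by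
  obtain ⟨v, hv, h1⟩ := hA u hu
  exact ⟨v, hv, h1.trans (by gcongr)⟩

theorem near_of_gapSub {A B : Submodule ℂ X} {ε : ℝ} (h : gapSub A B < ε) : NearSub ε A B := by
  intro u hu
  by_cases h0 : u = 0
  · exact ⟨0, B.zero_mem, by simp [h0]⟩
  have hn : ‖u‖ ≠ 0 := by simpa using h0
  have hn' : 0 < ‖u‖ := by positivity
  set w : X := ((‖u‖⁻¹ : ℝ) : ℂ) • u with hw
  have hwn : ‖w‖ = 1 := by
    rw [hw, norm_smul]; simp [hn]
  have hwA : w ∈ A := A.smul_mem _ hu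
  have hle : Metric.infDist w (B : Set X) ≤ gapSub A B := by
    apply le_csSup
    · refine ⟨1, ?_⟩
      rintro _ ⟨x, ⟨-, hx⟩, rfl⟩
      have := Metric.infDist_le_dist_of_mem (x := x) (s := (B : Set X)) B.zero_mem
      simpa [hx] using this
    · exact ⟨w, ⟨hwA, hwn⟩, rfl⟩
  obtain ⟨v, hv, hd⟩ := (Metric.infDist_lt_iff ⟨0, B.zero_mem⟩).1 (hle.trans_lt h)
  refine ⟨((‖u‖ : ℝ) : ℂ) • v, B.smul_mem _ hv, ?_⟩
  have hu' : u = ((‖u‖ : ℝ) : ℂ) • w := by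
    rw [hw, smul_smul, ← Complex.ofReal_mul, mul_inv_cancel₀ hn]; simp
  have : u - ((‖u‖ : ℝ) : ℂ) • v = ((‖u‖ : ℝ) : ℂ) • (w - v) := by
    rw [smul_sub, ← hu']
  rw [this, norm_smul]
  rw [dist_eq_norm] at hd
  simp only [Complex.norm_real, norm_norm]
  nlinarith

theorem quotRank_chain {A B C : Submodule ℂ X} (h1 : A ≤ B) (h2 : B ≤ C) :
    quotRank B C + quotRank A B = quotRank A C := by
  unfold quotRank
  have hle : A.comap C.subtype ≤ B.comap C.subtype := Submodule.comap_mono h1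
  rw [← (Submodule.quotientQuotientEquivQuotient _ _ hle).rank_eq,
    ← rank_quotient_add_rank_of_divisionRing ((B.comap C.subtype).map (A.comap C.subtype).mkQ)]
  congr 1
  let g : B →ₗ[ℂ] (C ⧸ A.comap C.subtype) := (A.comap C.subtype).mkQ ∘ₗ Submodule.inclusion h2
  have hk : LinearMap.ker g = A.comap B.subtype := by
    ext x
    simp [g, LinearMap.mem_ker]
  have hr : LinearMap.range g = (B.comap C.subtype).map (A.comap C.subtype).mkQ := by
    rw [LinearMap.range_comp, Submodule.range_inclusion]
  rw [← hk, ← hr]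
  exact g.quotKerEquivRange.rank_eq

theorem quotRank_self (A : Submodule ℂ X) : quotRank A A = 0 := by
  unfold quotRank
  rw [Submodule.comap_subtype_self]
  exact rank_subsingleton' _ _

theorem quotRank_sup (A B : Submodule ℂ X) :
    quotRank (A ⊓ B) A = quotRank B (A ⊔ B) :=
  (LinearMap.quotientInfEquivSupQuotient A B).rank_eq

theorem quotRank_span_le (A : Submodule ℂ X) (f : X) :
    quotRank A (A ⊔ Submodule.span ℂ {f}) ≤ 1 := by
  rw [sup_comm, ← quotRank_sup]
  unfold quotRank
  refine (rank_quotient_le _).trans ?_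
  refine (rank_span_le _).trans ?_
  simp

theorem quotRank_span_eq {A : Submodule ℂ X} {f : X} (hf : f ∉ A) :
    quotRank A (A ⊔ Submodule.span ℂ {f}) = 1 := by
  refine le_antisymm (quotRank_span_le A f) ?_
  rw [Cardinal.one_le_iff_ne_zero]
  unfold quotRank
  rw [← pos_iff_ne_zero, rank_pos_iff_nontrivial, Submodule.Quotient.nontrivial_iff]
  intro h
  apply hf
  rw [Submodule.comap_subtype_eq_top] at h
  exact h (Submodule.mem_sup_right (Submodule.mem_span_singleton_self f))

theorem quotRank_inf_span_le (M N : Submodule ℂ X) (f : X) :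
    quotRank (M ⊓ N) (M ⊓ (N ⊔ Submodule.span ℂ {f})) ≤ 1 := by
  have h := quotRank_sup (M ⊓ (N ⊔ Submodule.span ℂ {f})) N
  have e1 : M ⊓ (N ⊔ Submodule.span ℂ {f}) ⊓ N = M ⊓ N := by
    apply le_antisymm
    · exact le_inf (inf_le_left.trans inf_le_left) inf_le_right
    · exact le_inf (le_inf inf_le_left (inf_le_right.trans le_sup_left)) inf_le_right
  rw [e1] at h
  rw [h]
  refine le_trans ?_ (quotRank_span_le N f)
  rw [← quotRank_chain (A := N) (B := M ⊓ (N ⊔ Submodule.span ℂ {f}) ⊔ N)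
    (C := N ⊔ Submodule.span ℂ {f}) le_sup_right (sup_le inf_le_right le_sup_left)]
  exact le_add_self

theorem inf_span_eq {M N Y : Submodule ℂ X} {f : X} (hM : M ≤ Y) (hN : N ≤ Y) (hf : f ∉ Y) :
    M ⊓ (N ⊔ Submodule.span ℂ {f}) = M ⊓ N := by
  apply le_antisymm
  · rintro x ⟨hx, hx'⟩
    refine ⟨hx, ?_⟩
    obtain ⟨n, hn, g, hg, rfl⟩ := Submodule.mem_sup.1 hx'
    obtain ⟨c, rfl⟩ := Submodule.mem_span_singleton.1 hg
    by_cases hc : c = 0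
    · simpa [hc] using hn
    · exfalso; apply hf
      have := Y.sub_mem (hM hx) (hN hn)
      rw [add_sub_cancel_left] at this
      exact (Y.smul_mem_iff hc).1 this
  · exact inf_le_inf_left _ le_sup_left

theorem exists_family {A B : Submodule ℂ X} (h : QuotFin A B) :
    ∃ e : Fin (quotFinrank A B) → X, (∀ i, e i ∈ B) ∧
      ∀ c : Fin (quotFinrank A B) → ℂ, ∑ i, c i • e i ∈ A → c = 0 := by
  have : FiniteDimensional ℂ (↥B ⧸ A.comap B.subtype) := h
  let b := Module.finBasis ℂ (↥B ⧸ A.comap B.subtype)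
  choose e he using fun i => Submodule.Quotient.mk_surjective _ (b i)
  refine ⟨fun i => e i, fun i => (e i).2, fun c hc => ?_⟩
  have := Fintype.linearIndependent_iff.1 b.linearIndependent c ?_
  · exact funext this
  · have h2 : ∑ i, c i • e i ∈ A.comap B.subtype := by
      simpa using hc
    rw [← Submodule.Quotient.mk_eq_zero] at h2
    rw [← h2, ← Submodule.mkQ_apply, map_sum]
    refine Finset.sum_congr rfl fun i _ => ?_
    rw [map_smul, Submodule.mkQ_apply, he]

theorem le_quotRank {A B : Submodule ℂ X} {n : ℕ} (e : Fin n → X) (he : ∀ i, e i ∈ B)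
    (h : ∀ c : Fin n → ℂ, ∑ i, c i • e i ∈ A → c = 0) : (n : Cardinal) ≤ quotRank A B := by
  have li : LinearIndependent ℂ
      (fun i => (Submodule.Quotient.mk ⟨e i, he i⟩ : ↥B ⧸ A.comap B.subtype)) := by
    rw [Fintype.linearIndependent_iff]
    intro c hc
    refine fun i => congrFun (h c ?_) i
    have h2 : (Submodule.Quotient.mk (∑ i, c i • (⟨e i, he i⟩ : B)) :
        ↥B ⧸ A.comap B.subtype) = 0 := by
      rw [← hc, ← Submodule.mkQ_apply, map_sum]
      refine Finset.sum_congr rfl fun i _ => ?_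
      rw [map_smul, Submodule.mkQ_apply]
    rw [Submodule.Quotient.mk_eq_zero] at h2
    simpa using h2
  have := li.cardinal_lift_le_rank
  simpa [quotRank] using this

theorem quotRank_eq {A B : Submodule ℂ X} (h : QuotFin A B) :
    quotRank A B = (quotFinrank A B : Cardinal) := by
  have : FiniteDimensional ℂ (↥B ⧸ A.comap B.subtype) := h
  exact (Module.finrank_eq_rank _ _).symm

theorem quotFin_iff {A B : Submodule ℂ X} : QuotFin A B ↔ quotRank A B < Cardinal.aleph0 :=
  Module.rank_lt_aleph0_iff.symm

theorem perturb_family {Y₁ : Submodule ℂ X} (hY : IsClosed (Y₁ : Set X)) {n : ℕ} (e : Fin n → X)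
    (h : ∀ c : Fin n → ℂ, ∑ i, c i • e i ∈ Y₁ → c = 0) :
    ∃ θ > (0 : ℝ), ∀ (Y₁' : Submodule ℂ X) (e' : Fin n → X), NearSub θ Y₁' Y₁ →
      (∀ i, ‖e i - e' i‖ ≤ θ) → ∀ c : Fin n → ℂ, ∑ i, c i • e' i ∈ Y₁' → c = 0 := by
  have := hY
  let L : (Fin n → ℂ) →ₗ[ℂ] (X ⧸ Y₁) := Y₁.mkQ ∘ₗ Fintype.linearCombination ℂ e
  have hL : LinearMap.ker L = ⊥ := by
    rw [LinearMap.ker_eq_bot']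
    intro c hc
    apply h
    exact (Submodule.Quotient.mk_eq_zero _).1 hc
  obtain ⟨K, hK0, hK⟩ := L.exists_antilipschitzWith hL
  have key : ∀ c : Fin n → ℂ, ∀ y ∈ Y₁, ‖c‖ ≤ K * ‖∑ i, c i • e i - y‖ := by
    intro c y hy
    have h1 := hK.le_mul_dist c 0
    rw [dist_zero_right, map_zero, dist_zero_right] at h1
    refine h1.trans ?_
    gcongr
    have : L c = Submodule.Quotient.mk (∑ i, c i • e i - y) := by
      rw [Submodule.Quotient.mk_sub, (Submodule.Quotient.mk_eq_zero _).2 hy, sub_zero]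
      rfl
    rw [this]
    exact Submodule.Quotient.norm_mk_le _ _
  set A : ℝ := ∑ i, ‖e i‖ with hA
  have hA0 : 0 ≤ A := by positivity
  have hKn : (0 : ℝ) ≤ K := K.2
  set D : ℝ := K * (2 * n + A) with hD
  have hD0 : 0 ≤ D := by positivity
  refine ⟨1 / (D + 1), by positivity, ?_⟩
  set θ : ℝ := 1 / (D + 1) with hθ
  have hθ0 : 0 < θ := by positivity
  have hθ1 : θ ≤ 1 := by rw [hθ, div_le_one (by positivity)]; linarith
  have hθD : θ * D < 1 := by
    rw [hθ, one_div, inv_mul_lt_iff₀ (by positivity)]; linarith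
  intro Y₁' e' hnear hee c hc
  obtain ⟨y, hy, hyd⟩ := hnear _ hc
  set w := ∑ i, c i • e' i with hw
  set v := ∑ i, c i • e i with hv
  have h1 : ‖v - w‖ ≤ n * (‖c‖ * θ) := by
    rw [hv, hw, ← Finset.sum_sub_distrib]
    refine (norm_sum_le _ _).trans ?_
    refine (Finset.sum_le_card_nsmul _ _ (‖c‖ * θ) ?_).trans (by simp)
    intro i _
    rw [← smul_sub, norm_smul]
    exact mul_le_mul (norm_le_pi_norm c i) (hee i) (norm_nonneg _) (norm_nonneg _)
  have h2 : ‖v‖ ≤ ‖c‖ * A := by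
    rw [hv, hA, Finset.mul_sum]
    refine (norm_sum_le _ _).trans (Finset.sum_le_sum fun i _ => ?_)
    rw [norm_smul]
    gcongr
    exact norm_le_pi_norm c i
  have h3 : ‖w‖ ≤ ‖v‖ + ‖v - w‖ := by
    have : w = v - (v - w) := by abel
    calc ‖w‖ = ‖v - (v - w)‖ := by rw [← this]
      _ ≤ _ := norm_sub_le _ _
  have h4 : ‖v - y‖ ≤ ‖v - w‖ + ‖w - y‖ := norm_sub_le_norm_sub_add_norm_sub _ _ _
  have h5 := key c y hy
  have hc0 : 0 ≤ ‖c‖ := norm_nonneg c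
  have hw1 : ‖w‖ ≤ ‖c‖ * (A + n) := by
    have : (n : ℝ) * (‖c‖ * θ) ≤ n * (‖c‖ * 1) := by gcongr
    nlinarith
  have h6 : ‖v - y‖ ≤ θ * (‖c‖ * (2 * n + A)) := by
    have : θ * ‖w‖ ≤ θ * (‖c‖ * (A + n)) := by gcongr
    nlinarith
  have h7 : ‖c‖ ≤ ‖c‖ * (θ * D) := by
    calc ‖c‖ ≤ K * ‖v - y‖ := h5
      _ ≤ K * (θ * (‖c‖ * (2 * n + A))) := by gcongr
      _ = _ := by rw [hD]; ring
  have : ‖c‖ = 0 := by nlinarith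
  simpa using this

theorem span_bound {N : Submodule ℂ X} {f : X} {κ : ℝ} (hκ : 0 < κ)
    (h : ∀ n ∈ N, κ ≤ ‖f - n‖) (n : X) (hn : n ∈ N) (c : ℂ) :
    ‖c‖ ≤ 1 / κ * ‖n + c • f‖ ∧ ‖n‖ ≤ (1 + ‖f‖ / κ) * ‖n + c • f‖ := by
  have h1 : ‖c‖ ≤ 1 / κ * ‖n + c • f‖ := by
    by_cases hc : c = 0
    · subst hc; simp; positivity
    · have h2 := h (-(c⁻¹ • n)) (N.neg_mem (N.smul_mem _ hn))
      have h3 : n + c • f = c • (f - -(c⁻¹ • n)) := by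
        rw [sub_neg_eq_add, smul_add, smul_smul, mul_inv_cancel₀ hc, one_smul, add_comm]
      rw [h3, norm_smul]
      have : (0:ℝ) ≤ ‖c‖ := norm_nonneg c
      rw [one_div, inv_mul_eq_div, le_div_iff₀ hκ]
      gcongr
  refine ⟨h1, ?_⟩
  have h2 : ‖n‖ ≤ ‖n + c • f‖ + ‖c‖ * ‖f‖ := by
    rw [← norm_smul]
    calc ‖n‖ = ‖(n + c • f) - c • f‖ := by rw [add_sub_cancel_right]
      _ ≤ _ := norm_sub_le _ _
  calc ‖n‖ ≤ ‖n + c • f‖ + (1 / κ * ‖n + c • f‖) * ‖f‖ := h2.trans (by gcongr)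
    _ = _ := by ring

theorem near_span1 {N : Submodule ℂ X} (hN : IsClosed (N : Set X)) {f : X} (hf : f ∉ N)
    {ε : ℝ} (hε : 0 < ε) : ∃ η > (0 : ℝ), ∀ (N' : Submodule ℂ X) (f' : X), NearSub η N N' →
      ‖f - f'‖ ≤ η → NearSub ε (N ⊔ Submodule.span ℂ {f}) (N' ⊔ Submodule.span ℂ {f'}) := by
  have hκ : 0 < Metric.infDist f (N : Set X) :=
    (hN.notMem_iff_infDist_pos ⟨0, N.zero_mem⟩).1 hf
  set κ := Metric.infDist f (N : Set X) with hκd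
  have hk : ∀ n ∈ N, κ ≤ ‖f - n‖ := fun n hn => by
    rw [← dist_eq_norm]; exact Metric.infDist_le_dist_of_mem hn
  set D : ℝ := (1 + ‖f‖ / κ) + 1 / κ with hD
  have hD0 : 0 < D := by positivity
  refine ⟨ε / D, by positivity, fun N' f' hNN hff u hu => ?_⟩
  obtain ⟨n, hn, g, hg, rfl⟩ := Submodule.mem_sup.1 hu
  obtain ⟨c, rfl⟩ := Submodule.mem_span_singleton.1 hg
  obtain ⟨b1, b2⟩ := span_bound hκ hk n hn c
  obtain ⟨n', hn', hd⟩ := hNN n hn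
  refine ⟨n' + c • f', Submodule.add_mem_sup hn'
    (Submodule.smul_mem _ _ (Submodule.mem_span_singleton_self _)), ?_⟩
  have e1 : n + c • f - (n' + c • f') = (n - n') + c • (f - f') := by
    rw [smul_sub]; abel
  rw [e1]
  calc ‖(n - n') + c • (f - f')‖ ≤ ‖n - n'‖ + ‖c‖ * ‖f - f'‖ := by
        rw [← norm_smul]; exact norm_add_le _ _
    _ ≤ ε / D * ((1 + ‖f‖ / κ) * ‖n + c • f‖) + (1 / κ * ‖n + c • f‖) * (ε / D) := by
        refine add_le_add (hd.trans (by gcongr)) (by gcongr)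
    _ = ε / D * D * ‖n + c • f‖ := by rw [hD]; ring
    _ = ε * ‖n + c • f‖ := by rw [div_mul_cancel₀ _ hD0.ne']

theorem near_span2 {Y : Submodule ℂ X} {f : X} (hf : f ∈ Y) {ε κ : ℝ} (hε : 0 < ε) (hκ : 0 < κ) :
    ∃ η > (0 : ℝ), ∀ (Y' : Submodule ℂ X), NearSub η Y' Y → (∀ y ∈ Y', κ ≤ ‖f - y‖) →
      NearSub ε (Y' ⊔ Submodule.span ℂ {f}) Y := by
  set D : ℝ := 1 + ‖f‖ / κ with hD
  have hD0 : 0 < D := by positivity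
  refine ⟨ε / D, by positivity, fun Y' hYY hk u hu => ?_⟩
  obtain ⟨n, hn, g, hg, rfl⟩ := Submodule.mem_sup.1 hu
  obtain ⟨c, rfl⟩ := Submodule.mem_span_singleton.1 hg
  obtain ⟨-, b2⟩ := span_bound hκ hk n hn c
  obtain ⟨y, hy, hd⟩ := hYY n hn
  refine ⟨y + c • f, Y.add_mem hy (Y.smul_mem _ hf), ?_⟩
  rw [add_sub_add_right_eq_sub]
  calc ‖n - y‖ ≤ ε / D * (D * ‖n + c • f‖) := hd.trans (by gcongr)
    _ = ε * ‖n + c • f‖ := by rw [← mul_assoc, div_mul_cancel₀ _ hD0.ne']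

theorem iterate_surj {E : Type*} [NormedAddCommGroup E] [NormedSpace ℂ E] [CompleteSpace E]
    (T : E →L[ℂ] X) (Y : Submodule ℂ X) (hT : ∀ x, T x ∈ Y) {C : ℝ}
    (h : ∀ y ∈ Y, ∃ x, ‖x‖ ≤ C * ‖y‖ ∧ ‖y - T x‖ ≤ 1 / 2 * ‖y‖) :
    ∀ y ∈ Y, ∃ x, ‖x‖ ≤ 2 * C * ‖y‖ ∧ T x = y := by
  intro y hy
  choose! g hg1 hg2 using h
  let z : ℕ → X := fun k => Nat.rec y (fun _ w => w - T (g w)) k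
  have hz0 : z 0 = y := rfl
  have hzs : ∀ k, z (k + 1) = z k - T (g (z k)) := fun k => rfl
  have hzY : ∀ k, z k ∈ Y := by
    intro k
    induction k with
    | zero => exact hy
    | succ k ih => rw [hzs]; exact Y.sub_mem ih (hT _)
  have hzn : ∀ k, ‖z k‖ ≤ (1 / 2) ^ k * ‖y‖ := by
    intro k
    induction k with
    | zero => simp [hz0]
    | succ k ih =>
      rw [hzs, pow_succ]
      have := hg2 (z k) (hzY k)
      linarith
  by_cases hC : 0 ≤ C
  · have hs : ∀ k, ‖g (z k)‖ ≤ C * ‖y‖ * (1 / 2) ^ k := fun k => by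
      refine (hg1 _ (hzY k)).trans ?_
      calc C * ‖z k‖ ≤ C * ((1 / 2) ^ k * ‖y‖) := by gcongr; exact hzn k
        _ = _ := by ring
    have hgeo : HasSum (fun k : ℕ => C * ‖y‖ * (1 / 2 : ℝ) ^ k) (C * ‖y‖ * 2) :=
      hasSum_geometric_two.mul_left _
    have hsum : Summable fun k => g (z k) := Summable.of_norm_bounded hgeo.summable hs
    refine ⟨∑' k, g (z k), ?_, ?_⟩
    · refine (tsum_of_norm_bounded hgeo hs).trans (le_of_eq (by ring))
    · have h1 := (hsum.hasSum.mapL T).tendsto_sum_nat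
      have h2 : ∀ n, ∑ k ∈ Finset.range n, T (g (z k)) = y - z n := by
        intro n
        induction n with
        | zero => simp [hz0]
        | succ n ih => rw [Finset.sum_range_succ, ih, hzs]; abel
      have h3 : Filter.Tendsto z Filter.atTop (nhds 0) := by
        refine squeeze_zero_norm hzn ?_
        have := (tendsto_pow_atTop_nhds_zero_of_lt_one (r := (1 / 2 : ℝ)) (by norm_num)
          (by norm_num)).mul_const ‖y‖
        simpa using this
      have h4 : Filter.Tendsto (fun n => ∑ k ∈ Finset.range n, T (g (z k))) Filter.atTop
          (nhds y) := by
        simp_rw [h2]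
        simpa using tendsto_const_nhds.sub h3
      exact tendsto_nhds_unique h1 h4
  · have : ‖y‖ = 0 := by
      have h1 := hg1 y hy
      have h2 := norm_nonneg (g y)
      have h3 := norm_nonneg y
      nlinarith
    have hy0 : y = 0 := by simpa using this
    exact ⟨0, by simp [hy0], by simp [hy0]⟩

theorem open_sum [CompleteSpace X] {M N Y : Submodule ℂ X} (hM : IsClosed (M : Set X))
    (hN : IsClosed (N : Set X)) (hY : IsClosed (Y : Set X)) (h : M ⊔ N = Y) :
    ∃ C > (0 : ℝ), ∀ y ∈ Y, ∃ m ∈ M, ∃ n ∈ N, ‖m‖ ≤ C * ‖y‖ ∧ ‖n‖ ≤ C * ‖y‖ ∧ m + n = y := by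
  have := hM.completeSpace_coe
  have := hN.completeSpace_coe
  have := hY.completeSpace_coe
  let T : (M × N) →L[ℂ] Y := (M.subtypeL.coprod N.subtypeL).codRestrict Y (by
    rintro ⟨m, n⟩
    rw [← h]
    exact Submodule.add_mem_sup m.2 n.2)
  have hs : Function.Surjective T := by
    rintro ⟨y, hy⟩
    rw [← h] at hy
    obtain ⟨m, hm, n, hn, rfl⟩ := Submodule.mem_sup.1 hy
    exact ⟨(⟨m, hm⟩, ⟨n, hn⟩), rfl⟩
  obtain ⟨C, hC, hT⟩ := T.exists_preimage_norm_le hs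
  refine ⟨C, hC, fun y hy => ?_⟩
  obtain ⟨⟨m, n⟩, he, hb⟩ := hT ⟨y, hy⟩
  refine ⟨m, m.2, n, n.2, ?_, ?_, congrArg Subtype.val he⟩
  · exact (norm_fst_le (m, n)).trans hb
  · exact (norm_snd_le (m, n)).trans hb

theorem stable_sum [CompleteSpace X] {M N Y : Submodule ℂ X} (hM : IsClosed (M : Set X))
    (hN : IsClosed (N : Set X)) (hY : IsClosed (Y : Set X)) (h : M ⊔ N = Y) :
    ∃ C > (0 : ℝ), ∃ ε > (0 : ℝ), ∀ M' N' Y' : Submodule ℂ X, IsClosed (M' : Set X) →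
      IsClosed (N' : Set X) → M' ⊔ N' ≤ Y' → NearSub ε M M' → NearSub ε N N' → NearSub ε Y' Y →
      ∀ y ∈ Y', ∃ m ∈ M', ∃ n ∈ N', ‖m‖ ≤ C * ‖y‖ ∧ ‖n‖ ≤ C * ‖y‖ ∧ m + n = y := by
  obtain ⟨C, hC, hop⟩ := open_sum hM hN hY h
  refine ⟨2 * (4 * C), by positivity, 1 / (2 * (1 + 4 * C)), by positivity, ?_⟩
  set ε : ℝ := 1 / (2 * (1 + 4 * C)) with hε
  have hε0 : 0 < ε := by positivity
  have hε1 : ε * (1 + 4 * C) = 1 / 2 := by rw [hε]; field_simp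
  have hε2 : ε ≤ 1 := by nlinarith
  intro M' N' Y' hM' hN' hle nM nN nY
  have := hM'.completeSpace_coe
  have := hN'.completeSpace_coe
  let T : (M' × N') →L[ℂ] X := M'.subtypeL.coprod N'.subtypeL
  have hT : ∀ x, T x ∈ Y' := by
    rintro ⟨m, n⟩
    exact hle (Submodule.add_mem_sup m.2 n.2)
  have key := iterate_surj T Y' hT (C := 4 * C) ?_
  · intro y hy
    obtain ⟨⟨m, n⟩, hb, he⟩ := key y hy
    exact ⟨m, m.2, n, n.2, (norm_fst_le (m, n)).trans hb, (norm_snd_le (m, n)).trans hb, he⟩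
  · intro y' hy'
    obtain ⟨y, hy, hyd⟩ := nY y' hy'
    obtain ⟨m, hm, n, hn, bm, bn, hmn⟩ := hop y hy
    obtain ⟨m', hm', dm⟩ := nM m hm
    obtain ⟨n', hn', dn⟩ := nN n hn
    have hy0 := norm_nonneg y'
    have hyn : ‖y‖ ≤ 2 * ‖y'‖ := by
      have : ‖y‖ ≤ ‖y'‖ + ‖y' - y‖ := by
        calc ‖y‖ = ‖y' - (y' - y)‖ := by rw [sub_sub_cancel]
          _ ≤ _ := norm_sub_le _ _
      nlinarith
    have bm2 : ‖m‖ ≤ 2 * C * ‖y'‖ := by nlinarith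
    have bn2 : ‖n‖ ≤ 2 * C * ‖y'‖ := by nlinarith
    have hh : ∀ a b : X, ‖a - b‖ ≤ ε * ‖a‖ → ‖b‖ ≤ 2 * ‖a‖ := by
      intro a b hab
      have : ‖b‖ ≤ ‖a‖ + ‖a - b‖ := by
        calc ‖b‖ = ‖a - (a - b)‖ := by rw [sub_sub_cancel]
          _ ≤ _ := norm_sub_le _ _
      have := norm_nonneg a
      nlinarith
    refine ⟨(⟨m', hm'⟩, ⟨n', hn'⟩), ?_, ?_⟩
    · refine norm_prod_le_iff.2 ⟨?_, ?_⟩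
      · have := hh _ _ dm
        change ‖m'‖ ≤ _
        linarith
      · have := hh _ _ dn
        change ‖n'‖ ≤ _
        linarith
    · change ‖y' - (m' + n')‖ ≤ _
      have e : y' - (m' + n') = (y' - y) + (m - m') + (n - n') := by
        rw [← hmn]; abel
      rw [e]
      calc _ ≤ ‖y' - y‖ + ‖m - m'‖ + ‖n - n'‖ := norm_add₃_le
        _ ≤ ε * ‖y'‖ + ε * (2 * C * ‖y'‖) + ε * (2 * C * ‖y'‖) := by
          refine add_le_add (add_le_add hyd (dm.trans (by gcongr))) (dn.trans (by gcongr))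
        _ = ε * (1 + 4 * C) * ‖y'‖ := by ring
        _ = _ := by rw [hε1]

theorem closed_sum [CompleteSpace X] {M N Y : Submodule ℂ X} (hM : IsClosed (M : Set X))
    (hN : IsClosed (N : Set X)) (hY : IsClosed (Y : Set X)) (h : M ⊔ N ≤ Y)
    (hfin : QuotFin (M ⊔ N) Y) : IsClosed ((M ⊔ N : Submodule ℂ X) : Set X) := by
  have := hM.completeSpace_coe
  have := hN.completeSpace_coe
  have := hY.completeSpace_coe
  set P : Submodule ℂ Y := (M ⊔ N).comap Y.subtype with hP
  have : FiniteDimensional ℂ (Y ⧸ P) := hfin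
  obtain ⟨G, hG⟩ := P.exists_isCompl
  have : FiniteDimensional ℂ G := (Submodule.quotientEquivOfIsCompl P G hG).finiteDimensional
  have : CompleteSpace G := FiniteDimensional.complete ℂ G
  let S : (M × N) →L[ℂ] Y := (M.subtypeL.coprod N.subtypeL).codRestrict Y (by
    rintro ⟨m, n⟩
    exact h (Submodule.add_mem_sup m.2 n.2))
  have hS : ∀ x, S x ∈ P := by
    rintro ⟨m, n⟩
    exact Submodule.add_mem_sup (S := M) (T := N) m.2 n.2
  let T : ((M × N) × G) →L[ℂ] Y := S.coprod G.subtypeL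
  have hTa : ∀ x, T x = S x.1 + x.2 := fun x => rfl
  have hs : Function.Surjective T := by
    intro y
    have : y ∈ P ⊔ G := by rw [hG.sup_eq_top]; trivial
    obtain ⟨p, hp, g, hg, rfl⟩ := Submodule.mem_sup.1 this
    obtain ⟨m, hm, n, hn, hmn⟩ := Submodule.mem_sup.1 (show (p : X) ∈ M ⊔ N from hp)
    refine ⟨((⟨m, hm⟩, ⟨n, hn⟩), ⟨g, hg⟩), ?_⟩
    rw [hTa]
    congr 1
    exact Subtype.ext hmn
  have hpre : T ⁻¹' (P : Set Y) = {x | x.2 = 0} := by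
    ext x
    simp only [Set.mem_preimage, SetLike.mem_coe, Set.mem_ofPred_eq, hTa]
    rw [P.add_mem_iff_right (hS _)]
    constructor
    · intro hx
      have := (Submodule.disjoint_def.1 hG.disjoint) _ hx x.2.2
      exact Subtype.ext this
    · intro hx; rw [hx]; exact P.zero_mem
  have hPc : IsClosed (P : Set Y) := by
    rw [← (T.isQuotientMap hs).isClosed_preimage, hpre]
    exact isClosed_eq continuous_snd continuous_const
  have := hY.isClosedEmbedding_subtypeVal.isClosedMap _ hPc
  convert this
  ext x
  constructor
  · intro hx; exact ⟨⟨x, h hx⟩, hx, rfl⟩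
  · rintro ⟨y, hy, rfl⟩; exact hy

theorem tetrad_base [CompleteSpace X] {Y₁ M N Y₂ : Submodule ℂ X}
    (hY₁c : IsClosed (Y₁ : Set X)) (hMc : IsClosed (M : Set X))
    (hNc : IsClosed (N : Set X)) (hY₂c : IsClosed (Y₂ : Set X))
    (hfin₁ : QuotFin Y₁ (M ⊓ N)) (h : M ⊔ N = Y₂) :
    ∃ ε > (0 : ℝ), ∀ Y₁' M' N' Y₂' : Submodule ℂ X,
      IsClosed (M' : Set X) → IsClosed (N' : Set X) →
      Y₁' ≤ M' ⊓ N' → M' ⊔ N' ≤ Y₂' →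
      NearSub ε Y₁' Y₁ → NearSub ε M M' → NearSub ε N N' → NearSub ε Y₂' Y₂ →
      M' ⊔ N' = Y₂' ∧ quotRank Y₁ (M ⊓ N) ≤ quotRank Y₁' (M' ⊓ N') := by
  obtain ⟨C, hC, ε₀, hε₀, hst⟩ := stable_sum hMc hNc hY₂c h
  obtain ⟨e, he, hind⟩ := exists_family hfin₁
  obtain ⟨θ, hθ, hper⟩ := perturb_family hY₁c e hind
  set A : ℝ := ∑ i, ‖e i‖ with hA
  have hA0 : 0 ≤ A := by positivity
  have heA : ∀ i, ‖e i‖ ≤ A := fun i =>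
    Finset.single_le_sum (f := fun i => ‖e i‖) (fun _ _ => norm_nonneg _) (Finset.mem_univ i)
  set D : ℝ := (1 + 2 * C) * A + 1 with hD
  have hD0 : 0 < D := by positivity
  refine ⟨min ε₀ (min θ (θ / D)), by positivity, ?_⟩
  set ε := min ε₀ (min θ (θ / D)) with hε
  have hεpos : 0 < ε := by positivity
  have hε1 : ε ≤ ε₀ := min_le_left _ _
  have hε2 : ε ≤ θ := (min_le_right _ _).trans (min_le_left _ _)
  have hε3 : ε * D ≤ θ := by
    rw [← le_div_iff₀ hD0]; exact (min_le_right _ _).trans (min_le_right _ _)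
  intro Y₁' M' N' Y₂' hM' hN' hle1 hle2 n1 nM nN n2
  have hs := hst M' N' Y₂' hM' hN' hle2 (nM.mono hε1) (nN.mono hε1) (n2.mono hε1)
  refine ⟨le_antisymm hle2 fun y hy => ?_, ?_⟩
  · obtain ⟨m, hm, n, hn, -, -, rfl⟩ := hs y hy
    exact Submodule.add_mem_sup hm hn
  have hex : ∀ i, ∃ x ∈ M' ⊓ N', ‖e i - x‖ ≤ θ := by
    intro i
    obtain ⟨a, ha, da⟩ := nM (e i) (he i).1
    obtain ⟨b, hb, db⟩ := nN (e i) (he i).2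
    have hab : a - b ∈ Y₂' := hle2 (Submodule.sub_mem _ (Submodule.mem_sup_left ha)
      (Submodule.mem_sup_right hb))
    obtain ⟨m, hm, n, hn, bm, -, hmn⟩ := hs _ hab
    have hab2 : ‖a - b‖ ≤ 2 * (ε * ‖e i‖) := by
      have e1 : a - b = (e i - b) - (e i - a) := by abel
      rw [e1]
      refine (norm_sub_le _ _).trans (by linarith)
    refine ⟨a - m, ⟨M'.sub_mem ha hm, ?_⟩, ?_⟩
    · have : a - m = b + n := by
        rw [sub_eq_iff_eq_add, add_assoc, add_comm n m, hmn]; abel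
      rw [this]; exact N'.add_mem hb hn
    · have e2 : e i - (a - m) = (e i - a) + m := by abel
      rw [e2]
      calc ‖e i - a + m‖ ≤ ‖e i - a‖ + ‖m‖ := norm_add_le _ _
        _ ≤ ε * ‖e i‖ + C * (2 * (ε * ‖e i‖)) := by
          refine add_le_add da (bm.trans (by gcongr))
        _ = ε * ((1 + 2 * C) * ‖e i‖) := by ring
        _ ≤ ε * ((1 + 2 * C) * A) := by gcongr; exact heA i
        _ ≤ ε * D := by gcongr; rw [hD]; linarith
        _ ≤ θ := hε3
  choose e' he' hd using hex
  rw [quotRank_eq hfin₁]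
  exact le_quotRank e' he' (hper Y₁' e' (n1.mono hε2) hd)

theorem tetrad_induct [CompleteSpace X] {Y₁ M Y₂ : Submodule ℂ X}
    (hY₁c : IsClosed (Y₁ : Set X)) (hMc : IsClosed (M : Set X))
    (hY₂c : IsClosed (Y₂ : Set X)) (d : ℕ) :
    ∀ N : Submodule ℂ X, IsClosed (N : Set X) → M ⊔ N ≤ Y₂ → QuotFin Y₁ (M ⊓ N) →
    quotRank (M ⊔ N) Y₂ = d →
    ∃ ε > (0 : ℝ), ∀ Y₁' M' N' Y₂' : Submodule ℂ X,
      IsClosed (M' : Set X) → IsClosed (N' : Set X) →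
      Y₁' ≤ M' ⊓ N' → M' ⊔ N' ≤ Y₂' →
      NearSub ε Y₁' Y₁ → NearSub ε M M' → NearSub ε N N' → NearSub ε Y₂' Y₂ →
      quotRank (M' ⊔ N') Y₂' < Cardinal.aleph0 ∧
      quotRank Y₁ (M ⊓ N) + quotRank (M' ⊔ N') Y₂' ≤ quotRank Y₁' (M' ⊓ N') + d := by
  induction d with
  | zero =>
    intro N hNc hle hfin h0
    have heq : M ⊔ N = Y₂ := by
      refine le_antisymm hle ?_
      by_contra hcon
      have : quotRank (M ⊔ N) Y₂ ≠ 0 := by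
        unfold quotRank
        rw [← pos_iff_ne_zero, rank_pos_iff_nontrivial, Submodule.Quotient.nontrivial_iff]
        intro h
        rw [Submodule.comap_subtype_eq_top] at h
        exact hcon h
      exact this (by simpa using h0)
    obtain ⟨ε, hε, H⟩ := tetrad_base hY₁c hMc hNc hY₂c hfin heq
    refine ⟨ε, hε, fun Y₁' M' N' Y₂' hM' hN' hle1 hle2 n1 nM nN n2 => ?_⟩
    obtain ⟨h1, h2⟩ := H Y₁' M' N' Y₂' hM' hN' hle1 hle2 n1 nM nN n2
    rw [h1, quotRank_self]
    exact ⟨Cardinal.aleph0_pos, by simpa using h2⟩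
  | succ d ih =>
    intro N hNc hle hfin hd
    obtain ⟨f, hfY, hfMN⟩ : ∃ f ∈ Y₂, f ∉ M ⊔ N := by
      by_contra! hcon
      have : M ⊔ N = Y₂ := le_antisymm hle hcon
      rw [this, quotRank_self] at hd
      exact (Nat.cast_ne_zero (R := Cardinal)).2 (Nat.succ_ne_zero d) hd.symm
    have hfN : f ∉ N := fun h => hfMN (Submodule.mem_sup_right h)
    have hspY : Submodule.span ℂ {f} ≤ Y₂ := by simpa using hfY
    have hinf : M ⊓ (N ⊔ Submodule.span ℂ {f}) = M ⊓ N :=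
      inf_span_eq le_sup_left le_sup_right hfMN
    have hle₁ : M ⊔ (N ⊔ Submodule.span ℂ {f}) ≤ Y₂ := by
      rw [← sup_assoc]; exact sup_le hle hspY
    have hd₁ : quotRank (M ⊔ (N ⊔ Submodule.span ℂ {f})) Y₂ = d := by
      have := quotRank_chain (A := M ⊔ N) (B := M ⊔ N ⊔ Submodule.span ℂ {f}) (C := Y₂)
        le_sup_left (sup_le hle hspY)
      rw [quotRank_span_eq hfMN, hd, Nat.cast_succ, Cardinal.add_one_inj, sup_assoc] at this
      exact this
    obtain ⟨ε₁, hε₁, H⟩ := ih (N ⊔ Submodule.span ℂ {f})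
      (Submodule.isClosed_sup_finiteDimensional _ _ hNc) hle₁ (by rwa [hinf]) hd₁
    rw [hinf] at H
    obtain ⟨η, hη, hs1⟩ := near_span1 hNc hfN hε₁
    obtain ⟨ζ, hζ, hs2⟩ := near_span2 hfY hε₁ hη
    refine ⟨min ε₁ (min η ζ), by positivity, ?_⟩
    set ε := min ε₁ (min η ζ) with hε
    have hεa : ε ≤ ε₁ := min_le_left _ _
    have hεb : ε ≤ η := (min_le_right _ _).trans (min_le_left _ _)
    have hεc : ε ≤ ζ := (min_le_right _ _).trans (min_le_right _ _)
    intro Y₁' M' N' Y₂' hM' hN' hle1 hle2 n1 nM nN n2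
    by_cases hcase : ∃ f' ∈ Y₂', ‖f - f'‖ ≤ η
    · obtain ⟨f', hf', hff⟩ := hcase
      have hspY' : Submodule.span ℂ {f'} ≤ Y₂' := by simpa using hf'
      have hinc : M' ⊓ N' ≤ M' ⊓ (N' ⊔ Submodule.span ℂ {f'}) := inf_le_inf_left _ le_sup_left
      obtain ⟨k1, k2⟩ := H Y₁' M' (N' ⊔ Submodule.span ℂ {f'}) Y₂' hM'
        (Submodule.isClosed_sup_finiteDimensional _ _ hN')
        (hle1.trans hinc)
        (by rw [← sup_assoc]; exact sup_le hle2 hspY')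
        (n1.mono hεa) (nM.mono hεa) (hs1 N' f' (nN.mono hεb) hff) (n2.mono hεa)
      rw [← sup_assoc] at k1 k2
      by_cases hmem : f' ∈ M' ⊔ N'
      · have e1 : M' ⊔ N' ⊔ Submodule.span ℂ {f'} = M' ⊔ N' := by
          rw [sup_eq_left]; simpa using hmem
        rw [e1] at k1 k2
        refine ⟨k1, k2.trans ?_⟩
        rw [← quotRank_chain hle1 hinc, Nat.cast_succ]
        calc _ ≤ 1 + quotRank Y₁' (M' ⊓ N') + (d : Cardinal) := by
              gcongr; exact quotRank_inf_span_le _ _ _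
          _ = _ := by ring
      · have e1 := quotRank_chain (A := M' ⊔ N') (B := M' ⊔ N' ⊔ Submodule.span ℂ {f'}) (C := Y₂')
          le_sup_left (sup_le hle2 hspY')
        rw [quotRank_span_eq hmem] at e1
        rw [inf_span_eq le_sup_left le_sup_right hmem] at k2
        rw [← e1]
        refine ⟨Cardinal.add_lt_aleph0 k1 Cardinal.one_lt_aleph0, ?_⟩
        rw [← add_assoc, Nat.cast_succ, ← add_assoc]
        gcongr
    · push Not at hcase
      have hfY' : f ∉ Y₂' := fun h => by
        have := hcase f h
        rw [sub_self, norm_zero] at this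
        linarith
      have e0 := inf_span_eq (le_sup_left.trans hle2) (le_sup_right.trans hle2) hfY'
      obtain ⟨k1, k2⟩ := H Y₁' M' (N' ⊔ Submodule.span ℂ {f}) (Y₂' ⊔ Submodule.span ℂ {f}) hM'
        (Submodule.isClosed_sup_finiteDimensional _ _ hN')
        (by rw [e0]; exact hle1)
        (by rw [← sup_assoc]; exact sup_le_sup_right hle2 _)
        (n1.mono hεa) (nM.mono hεa)
        (hs1 N' f (nN.mono hεb) (by rw [sub_self, norm_zero]; exact hη.le))
        (hs2 Y₂' (n2.mono hεc) fun y hy => (hcase y hy).le)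
      have e1 := quotRank_sup Y₂' (M' ⊔ N' ⊔ Submodule.span ℂ {f})
      rw [inf_span_eq le_rfl hle2 hfY', inf_eq_right.2 hle2, ← sup_assoc,
        sup_eq_left.2 hle2] at e1
      rw [← sup_assoc, ← e1] at k1 k2
      rw [e0] at k2
      refine ⟨k1, k2.trans ?_⟩
      rw [Nat.cast_succ]
      gcongr
      exact self_le_add_right _ _
end

/-- Lower semicontinuity of the index of a Fredholm tetrad
with respect to the one-sided gaps `δ(Y₁',Y₁)`, `δ(M,M')`, `δ(N,N')`,
`δ(Y₂',Y₂)`. -/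
theorem stable_tetrad_index_ge {X : Type*} [NormedAddCommGroup X] [NormedSpace ℂ X]
    [CompleteSpace X] (Y₁ M N Y₂ : Submodule ℂ X)
    (hY₁c : IsClosed (Y₁ : Set X)) (hMc : IsClosed (M : Set X))
    (hNc : IsClosed (N : Set X)) (hY₂c : IsClosed (Y₂ : Set X))
    (hMNc : IsClosed ((M ⊔ N : Submodule ℂ X) : Set X))
    (h₁ : Y₁ ≤ M ⊓ N) (h₂ : M ⊔ N ≤ Y₂)
    (hfin₁ : QuotFin Y₁ (M ⊓ N)) (hfin₂ : QuotFin (M ⊔ N) Y₂) :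
    ∃ ε > (0 : ℝ), ∀ Y₁' M' N' Y₂' : Submodule ℂ X,
      IsClosed (Y₁' : Set X) → IsClosed (M' : Set X) → IsClosed (N' : Set X) →
      IsClosed (Y₂' : Set X) →
      Y₁' ≤ M' ⊓ N' → M' ⊔ N' ≤ Y₂' →
      gapSub Y₁' Y₁ < ε → gapSub M M' < ε → gapSub N N' < ε → gapSub Y₂' Y₂ < ε →
      IsClosed ((M' ⊔ N' : Submodule ℂ X) : Set X) ∧
        QuotFin (M' ⊔ N') Y₂' ∧
        tetradIndex Y₁ M N Y₂ ≤ tetradIndex Y₁' M' N' Y₂' := by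
  obtain ⟨ε, hε, H⟩ := tetrad_induct hY₁c hMc hY₂c (quotFinrank (M ⊔ N) Y₂) N hNc h₂ hfin₁
    (quotRank_eq hfin₂)
  refine ⟨ε, hε, fun Y₁' M' N' Y₂' _ hM' hN' hY₂' hle1 hle2 g1 gM gN g2 => ?_⟩
  obtain ⟨k1, k2⟩ := H Y₁' M' N' Y₂' hM' hN' hle1 hle2 (near_of_gapSub g1) (near_of_gapSub gM)
    (near_of_gapSub gN) (near_of_gapSub g2)
  have hf := quotFin_iff.2 k1
  refine ⟨closed_sum hM' hN' hY₂' hle2 hf, hf, ?_⟩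
  unfold tetradIndex eQuotDim
  rw [if_pos hfin₁, if_pos hfin₂, if_pos hf]
  split_ifs with hf1
  · rw [quotRank_eq hfin₁, quotRank_eq hf, quotRank_eq hf1] at k2
    have k3 : quotFinrank Y₁ (M ⊓ N) + quotFinrank (M' ⊔ N') Y₂' ≤
        quotFinrank Y₁' (M' ⊓ N') + quotFinrank (M ⊔ N) Y₂ := by exact_mod_cast k2
    have k4 : (quotFinrank Y₁ (M ⊓ N) : ℝ) + quotFinrank (M' ⊔ N') Y₂' ≤
        quotFinrank Y₁' (M' ⊓ N') + quotFinrank (M ⊔ N) Y₂ := by exact_mod_cast k3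
    rw [← EReal.coe_sub, ← EReal.coe_sub, EReal.coe_le_coe_iff]
    linarith
  · rw [EReal.top_sub_coe]
    exact le_top
end
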